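/- Let C ⊆ S be fork-convex and far-reaching, let t₁ ≤ t₂ in [0,T], and let g be a nonnegative F_{t₂}-measurable integrable random variable such that esssup_{Y∈C} E[g·Δ_{t₂,t₁}Y | F_{t₁}] ≤ 1 a.s. Define the process X by X_t = 1 for t < t₁, X_t = esssup_{Y∈C} E[g·Δ_{t₂,t}Y | F_t] for t ∈ [t₁,t₂), and X_t = g for t ∈ [t₂,T]. Then X·Y is a supermartingale for every Y ∈ C, and X admits a càdlàg modification. -/

import Mathlib

open MeasureTheory Filter Set
open scoped NNReal ENNReal

variable {Ω : Type*}

/-- A real function is càdlàg on `[0,T]`: right-continuous at every `t ∈ [0,T)` and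
with left limits at every `t ∈ (0,T]`. -/
def CadlagOn (T : ℝ) (f : ℝ → ℝ) : Prop :=
  (∀ t ∈ Set.Ico (0 : ℝ) T, Filter.Tendsto f (nhdsWithin t (Set.Ioi t)) (nhds (f t))) ∧
  (∀ t ∈ Set.Ioc (0 : ℝ) T, ∃ L : ℝ, Filter.Tendsto f (nhdsWithin t (Set.Iio t)) (nhds L))

/-- A positive process on `[0,T]`: adapted, nonnegative, with càdlàg paths. -/
def PosProc {m0 : MeasurableSpace Ω} (μ : Measure Ω) (T : ℝ)
    (ℱ : Filtration ℝ m0) (X : ℝ → Ω → ℝ) : Prop :=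
  (∀ t ∈ Set.Icc (0 : ℝ) T, StronglyMeasurable[ℱ t] (X t)) ∧
  (∀ᵐ ω ∂μ, ∀ t ∈ Set.Icc (0 : ℝ) T, 0 ≤ X t ω) ∧
  (∀ᵐ ω ∂μ, CadlagOn T (fun t => X t ω))

/-- A nonnegative càdlàg supermartingale on `[0,T]`. -/
def SuperMG {m0 : MeasurableSpace Ω} (μ : Measure Ω) (T : ℝ)
    (ℱ : Filtration ℝ m0) (X : ℝ → Ω → ℝ) : Prop :=
  PosProc μ T ℱ X ∧ (∀ t ∈ Set.Icc (0 : ℝ) T, Integrable (X t) μ) ∧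
  ∀ s t : ℝ, s ∈ Set.Icc (0 : ℝ) T → t ∈ Set.Icc (0 : ℝ) T → s ≤ t →
    μ[X t | ℱ s] ≤ᵐ[μ] X s

/-- Membership in `S₁`: a nonnegative càdlàg supermartingale with `Y₀ ≤ 1`. -/
def S1mem {m0 : MeasurableSpace Ω} (μ : Measure Ω) (T : ℝ)
    (ℱ : Filtration ℝ m0) (X : ℝ → Ω → ℝ) : Prop :=
  SuperMG μ T ℱ X ∧ ∀ᵐ ω ∂μ, X 0 ω ≤ 1

/-- Membership in `V`: a nonincreasing positive process with `B₀ ≤ 1`. -/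
def Vmem {m0 : MeasurableSpace Ω} (μ : Measure Ω) (T : ℝ)
    (ℱ : Filtration ℝ m0) (B : ℝ → Ω → ℝ) : Prop :=
  PosProc μ T ℱ B ∧
  (∀ᵐ ω ∂μ, ∀ s ∈ Set.Icc (0 : ℝ) T, ∀ t ∈ Set.Icc (0 : ℝ) T, s ≤ t → B t ω ≤ B s ω) ∧
  (∀ᵐ ω ∂μ, B 0 ω ≤ 1)

/-- The process polar `C^×`: all positive processes `Y` such that `XY` is a
supermartingale with `X₀Y₀ ≤ 1` for every `X ∈ C`. -/
def procPolar {m0 : MeasurableSpace Ω} (μ : Measure Ω) (T : ℝ)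
    (ℱ : Filtration ℝ m0) (C : Set (ℝ → Ω → ℝ)) : Set (ℝ → Ω → ℝ) :=
  {Y | PosProc μ T ℱ Y ∧ ∀ X ∈ C,
    SuperMG μ T ℱ (fun t ω => X t ω * Y t ω) ∧ ∀ᵐ ω ∂μ, X 0 ω * Y 0 ω ≤ 1}

/-- (Process) solidity: stability under multiplication by elements of `V`. -/
def ProcSolid {m0 : MeasurableSpace Ω} (μ : Measure Ω) (T : ℝ)
    (ℱ : Filtration ℝ m0) (C : Set (ℝ → Ω → ℝ)) : Prop :=
  ∀ Y ∈ C, ∀ B : ℝ → Ω → ℝ, Vmem μ T ℱ B → (fun t ω => Y t ω * B t ω) ∈ C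

/-- Fork-convexity (with the convention `0/0 = 0`, which holds for Lean division). -/
def ForkConvex {m0 : MeasurableSpace Ω} (μ : Measure Ω) (T : ℝ)
    (ℱ : Filtration ℝ m0) (C : Set (ℝ → Ω → ℝ)) : Prop :=
  ∀ s ∈ Set.Icc (0 : ℝ) T, ∀ h : Ω → ℝ, StronglyMeasurable[ℱ s] h →
    (∀ ω, 0 ≤ h ω) → (∀ ω, h ω ≤ 1) →
    ∀ Y1 ∈ C, ∀ Y2 ∈ C, ∀ Y3 ∈ C,
      (fun t ω => if t < s then Y1 t ω
        else Y1 s ω * (h ω * (Y2 t ω / Y2 s ω) + (1 - h ω) * (Y3 t ω / Y3 s ω))) ∈ C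

/-- Fatou convergence of a sequence of positive processes. -/
def FatouConv {m0 : MeasurableSpace Ω} (μ : Measure Ω) (T : ℝ) (Yn : ℕ → ℝ → Ω → ℝ) (Y : ℝ → Ω → ℝ) : Prop :=
  ∃ T' : Set ℝ, T'.Countable ∧ T' ⊆ Set.Icc 0 T ∧ Set.Icc (0 : ℝ) T ⊆ closure T' ∧
    ∀ᵐ ω ∂μ,
      (∀ t ∈ Set.Ico (0 : ℝ) T,
        (ENNReal.ofReal (Y t ω)
            = Filter.liminf
                (fun s => Filter.liminf (fun n => ENNReal.ofReal (Yn n s ω)) Filter.atTop)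
                (nhdsWithin t (Set.Ioi t ∩ T')) ∧
         ENNReal.ofReal (Y t ω)
            = Filter.limsup
                (fun s => Filter.limsup (fun n => ENNReal.ofReal (Yn n s ω)) Filter.atTop)
                (nhdsWithin t (Set.Ioi t ∩ T')))) ∧
      Filter.Tendsto (fun n => Yn n T ω) Filter.atTop (nhds (Y T ω))

/-- Closedness under Fatou convergence. -/
def FatouClosed {m0 : MeasurableSpace Ω} (μ : Measure Ω) (T : ℝ)
    (ℱ : Filtration ℝ m0) (C : Set (ℝ → Ω → ℝ)) : Prop :=
  ∀ (Yn : ℕ → ℝ → Ω → ℝ) (Y : ℝ → Ω → ℝ), (∀ n, Yn n ∈ C) → PosProc μ T ℱ Y →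
    FatouConv μ T Yn Y → Y ∈ C

/-- A set of processes is far-reaching if it has an element with `Y_T > 0` a.s. -/
def FarReaching {m0 : MeasurableSpace Ω} (μ : Measure Ω) (T : ℝ) (C : Set (ℝ → Ω → ℝ)) : Prop :=
  ∃ Y ∈ C, ∀ᵐ ω ∂μ, 0 < Y T ω

/-- The solid, fork-convex hull of `C`: the smallest (process) solid and fork-convex
subset of `S₁` containing `C`. -/
def solidForkHull {m0 : MeasurableSpace Ω} (μ : Measure Ω) (T : ℝ)
    (ℱ : Filtration ℝ m0) (C : Set (ℝ → Ω → ℝ)) : Set (ℝ → Ω → ℝ) :=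
  ⋂₀ {D | D ⊆ {X | S1mem μ T ℱ X} ∧ ProcSolid μ T ℱ D ∧ ForkConvex μ T ℱ D ∧ C ⊆ D}

/-- Extended (`[0,∞]`-valued) conditional expectation of a (nonnegative) function,
defined as the supremum of the conditional expectations of its truncations. -/
noncomputable def econd {mΩ : MeasurableSpace Ω} (μ : Measure Ω)
    (m : MeasurableSpace Ω) (f : Ω → ℝ) : Ω → ℝ≥0∞ :=
  fun ω => ⨆ n : ℕ, ENNReal.ofReal ((μ[fun ω' => min (f ω') n | m]) ω)

/-- The supermartingale property on `[0,T]` (without path regularity). -/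
def SupermartProp {m0 : MeasurableSpace Ω} (μ : Measure Ω) (T : ℝ)
    (ℱ : Filtration ℝ m0) (Z : ℝ → Ω → ℝ) : Prop :=
  (∀ t ∈ Set.Icc (0 : ℝ) T, StronglyMeasurable[ℱ t] (Z t)) ∧
  (∀ t ∈ Set.Icc (0 : ℝ) T, Integrable (Z t) μ) ∧
  ∀ s t : ℝ, s ∈ Set.Icc (0 : ℝ) T → t ∈ Set.Icc (0 : ℝ) T → s ≤ t →
    μ[Z t | ℱ s] ≤ᵐ[μ] Z s

section Helpers

open scoped Topology

/-- `f` has `k` successive moves from `≤ a` to `≥ b` at points of `D` to the right of `x`. -/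
def HasUpcrossings (D : Set ℝ) (f : ℝ → ℝ) (a b : ℝ) : ℕ → ℝ → Prop
  | 0, _ => True
  | k + 1, x => ∃ s ∈ D, ∃ t ∈ D, x < s ∧ s < t ∧ f s ≤ a ∧ b ≤ f t ∧ HasUpcrossings D f a b k t

theorem HasUpcrossings.mono_left {D : Set ℝ} {f : ℝ → ℝ} {a b : ℝ} {k : ℕ} {x y : ℝ}
    (h : HasUpcrossings D f a b k x) (hyx : y ≤ x) : HasUpcrossings D f a b k y := by
  cases k with
  | zero => trivial
  | succ k =>
    obtain ⟨s, hs, t, ht, hxs, h⟩ := h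
    exact ⟨s, hs, t, ht, hyx.trans_lt hxs, h⟩

theorem HasUpcrossings.mono_set {D E : Set ℝ} (hDE : D ⊆ E) {f : ℝ → ℝ} {a b : ℝ} {k : ℕ} {x : ℝ}
    (h : HasUpcrossings D f a b k x) : HasUpcrossings E f a b k x := by
  induction k generalizing x with
  | zero => trivial
  | succ k ih =>
    obtain ⟨s, hs, t, ht, hxs, hst, hfs, hft, h⟩ := h
    exact ⟨s, hDE hs, t, hDE ht, hxs, hst, hfs, hft, ih h⟩

theorem HasUpcrossings.exists_of_iUnion {F : ℕ → Set ℝ} (hF : Monotone F) {f : ℝ → ℝ} {a b : ℝ}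
    {k : ℕ} {x : ℝ} (h : HasUpcrossings (⋃ n, F n) f a b k x) :
    ∃ n, HasUpcrossings (F n) f a b k x := by
  induction k generalizing x with
  | zero => exact ⟨0, trivial⟩
  | succ k ih =>
    obtain ⟨s, hs, t, ht, hxs, hst, hfs, hft, h⟩ := h
    obtain ⟨i, hi⟩ := mem_iUnion.1 hs
    obtain ⟨j, hj⟩ := mem_iUnion.1 ht
    obtain ⟨l, hl⟩ := ih h
    refine ⟨max i (max j l), s, hF (le_max_left _ _) hi, t,
      hF ((le_max_left _ _).trans (le_max_right _ _)) hj, hxs, hst, hfs, hft,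
      hl.mono_set (hF ((le_max_right _ _).trans (le_max_right _ _)))⟩

/-- Oscillation immediately to the right of `t` produces arbitrarily many upcrossings. -/
theorem hasUpcrossings_of_frequently_right {D : Set ℝ} {f : ℝ → ℝ} {a b t : ℝ}
    (ha : ∃ᶠ s in 𝓝[D ∩ Ioi t] t, f s < a) (hb : ∃ᶠ s in 𝓝[D ∩ Ioi t] t, b < f s) (k : ℕ) :
    ∃ x, t < x ∧ HasUpcrossings D f a b k x := by
  have key : ∀ {p : ℝ → Prop}, (∃ᶠ s in 𝓝[D ∩ Ioi t] t, p s) → ∀ x, t < x →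
      ∃ s ∈ D, t < s ∧ s < x ∧ p s := by
    intro p hp x hx
    have h1 : ∀ᶠ s in 𝓝[D ∩ Ioi t] t, s ∈ D ∩ Ioi t := eventually_mem_nhdsWithin
    have h2 : ∀ᶠ s in 𝓝[D ∩ Ioi t] t, s < x := nhdsWithin_le_nhds (Iio_mem_nhds hx)
    obtain ⟨s, hs, ⟨hsD, hts⟩, hsx⟩ := (hp.and_eventually (h1.and h2)).exists
    exact ⟨s, hsD, hts, hsx, hs⟩
  induction k with
  | zero => exact ⟨t + 1, by simp, trivial⟩
  | succ k ih =>
    obtain ⟨x, hx, h⟩ := ih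
    obtain ⟨r, hrD, htr, hrx, hr⟩ := key hb x hx
    obtain ⟨s, hsD, hts, hsr, hs⟩ := key ha r htr
    exact ⟨(t + s) / 2, by linarith, s, hsD, r, hrD, by linarith, hsr, hs.le, hr.le,
      h.mono_left hrx.le⟩

/-- Oscillation immediately to the left of `t` produces arbitrarily many upcrossings. -/
theorem hasUpcrossings_of_frequently_left {D : Set ℝ} {f : ℝ → ℝ} {a b t : ℝ}
    (ha : ∃ᶠ s in 𝓝[D ∩ Iio t] t, f s < a) (hb : ∃ᶠ s in 𝓝[D ∩ Iio t] t, b < f s) (k : ℕ)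
    {x : ℝ} (hx : x < t) : HasUpcrossings D f a b k x := by
  have key : ∀ {p : ℝ → Prop}, (∃ᶠ s in 𝓝[D ∩ Iio t] t, p s) → ∀ x, x < t →
      ∃ s ∈ D, s < t ∧ x < s ∧ p s := by
    intro p hp x hx
    have h1 : ∀ᶠ s in 𝓝[D ∩ Iio t] t, s ∈ D ∩ Iio t := eventually_mem_nhdsWithin
    have h2 : ∀ᶠ s in 𝓝[D ∩ Iio t] t, x < s := nhdsWithin_le_nhds (Ioi_mem_nhds hx)
    obtain ⟨s, hs, ⟨hsD, hts⟩, hsx⟩ := (hp.and_eventually (h1.and h2)).exists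
    exact ⟨s, hsD, hts, hsx, hs⟩
  induction k generalizing x with
  | zero => trivial
  | succ k ih =>
    obtain ⟨s, hsD, hst, hxs, hs⟩ := key ha x hx
    obtain ⟨r, hrD, hrt, hsr, hr⟩ := key hb s hst
    exact ⟨s, hsD, r, hrD, hxs, hsr, hs.le, hr.le, ih hrt⟩

/-- A bounded function on `D` with finitely many upcrossings of every rational interval has
one-sided limits along `D`. -/
theorem exists_tendsto_of_not_hasUpcrossings {D : Set ℝ} {f : ℝ → ℝ} {K x₀ : ℝ}
    (hbd : ∀ s ∈ D, |f s| ≤ K)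
    (hup : ∀ a b : ℚ, (a : ℝ) < b → ∃ k, ¬ HasUpcrossings D f a b k x₀) :
    (∀ t, x₀ ≤ t → ∃ L, Tendsto f (𝓝[D ∩ Ioi t] t) (𝓝 L)) ∧
      ∀ t, x₀ < t → ∃ L, Tendsto f (𝓝[D ∩ Iio t] t) (𝓝 L) := by
  have hbdd : ∀ (E : Set ℝ) (t : ℝ), (𝓝[D ∩ E] t).IsBoundedUnder (· ≤ ·) f ∧
      (𝓝[D ∩ E] t).IsBoundedUnder (· ≥ ·) f := by
    intro E t
    have h : ∀ᶠ s in 𝓝[D ∩ E] t, s ∈ D ∩ E := eventually_mem_nhdsWithin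
    exact ⟨⟨K, eventually_map.2 (h.mono fun s hs => (abs_le.1 (hbd s hs.1)).2)⟩,
      ⟨-K, eventually_map.2 (h.mono fun s hs => (abs_le.1 (hbd s hs.1)).1)⟩⟩
  have hdense : Dense (range ((↑) : ℚ → ℝ)) := Rat.denseRange_cast
  constructor
  · intro t ht
    refine tendsto_of_no_upcrossings hdense ?_ (hbdd _ t).1 (hbdd _ t).2
    rintro _ ⟨a, rfl⟩ _ ⟨b, rfl⟩ hab ⟨ha, hb⟩
    obtain ⟨k, hk⟩ := hup a b hab
    obtain ⟨x, hx, h⟩ := hasUpcrossings_of_frequently_right ha hb k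
    exact hk (h.mono_left (ht.trans hx.le))
  · intro t ht
    refine tendsto_of_no_upcrossings hdense ?_ (hbdd _ t).1 (hbdd _ t).2
    rintro _ ⟨a, rfl⟩ _ ⟨b, rfl⟩ hab ⟨ha, hb⟩
    obtain ⟨k, hk⟩ := hup a b hab
    exact hk (hasUpcrossings_of_frequently_left ha hb k ht)

/-- Along a monotone time change, successive upcrossings at times in its range are counted by
Mathlib's `upperCrossingTime`. -/
theorem upperCrossingTime_le_of_hasUpcrossings {S : ℝ → Ω → ℝ} {u : ℕ → ℝ} (hu : Monotone u)
    {F : Set ℝ} {N : ℕ} (hF : ∀ x ∈ F, ∃ n < N, u n = x) {a b : ℝ} {ω : Ω} (k : ℕ) :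
    ∀ (j i : ℕ), i < N → upperCrossingTime a b (fun n => S (u n)) N j ω ≤ i →
      HasUpcrossings F (fun t => S t ω) a b k (u i) →
      upperCrossingTime a b (fun n => S (u n)) N (j + k) ω < N := by
  induction k with
  | zero => intro j i hi hj _; exact hj.trans_lt hi
  | succ k ih =>
    rintro j i hi hj ⟨s, hs, t, ht, hxs, hst, hfs, hft, h⟩
    obtain ⟨p, hp, rfl⟩ := hF s hs
    obtain ⟨q, hq, rfl⟩ := hF t ht
    have hip : i ≤ p := (hu.reflect_lt hxs).le
    have hpq : p ≤ q := (hu.reflect_lt hst).le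
    have h1 : lowerCrossingTime a b (fun n => S (u n)) N j ω ≤ p :=
      hittingBtwn_le_of_mem (hj.trans hip) hp.le hfs
    have h2 : upperCrossingTime a b (fun n => S (u n)) N (j + 1) ω ≤ q := by
      rw [upperCrossingTime_succ_eq]
      exact hittingBtwn_le_of_mem (h1.trans hpq) hq.le hft
    have := ih (j + 1) q hq h2 h
    rwa [show j + (k + 1) = j + 1 + k by ring]

theorem le_upcrossingsBefore_of_hasUpcrossings {S : ℝ → Ω → ℝ} {u : ℕ → ℝ} (hu : Monotone u)
    {F : Set ℝ} {N : ℕ} (hF : ∀ x ∈ F, ∃ n < N, u n = x) {a b : ℝ} (hab : a < b) {ω : Ω} {k : ℕ}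
    {x : ℝ} (h : HasUpcrossings F (fun t => S t ω) a b k x) :
    k ≤ upcrossingsBefore a b (fun n => S (u n)) N ω := by
  cases k with
  | zero => exact Nat.zero_le _
  | succ k =>
    obtain ⟨s, hs, t, ht, hxs, hst, hfs, hft, h⟩ := h
    obtain ⟨p, hp, rfl⟩ := hF s hs
    obtain ⟨q, hq, rfl⟩ := hF t ht
    have hpq : p ≤ q := (hu.reflect_lt hst).le
    have h1 : lowerCrossingTime a b (fun n => S (u n)) N 0 ω ≤ p :=
      hittingBtwn_le_of_mem (by simp) hp.le hfs
    have h2 : upperCrossingTime a b (fun n => S (u n)) N 1 ω ≤ q := by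
      rw [upperCrossingTime_succ_eq]
      exact hittingBtwn_le_of_mem (h1.trans hpq) hq.le hft
    have h3 := upperCrossingTime_le_of_hasUpcrossings hu hF k 1 q hq h2 h
    rw [add_comm] at h3
    exact le_csSup (upperCrossingTime_lt_bddAbove hab) h3

/-- A nonempty finite set of reals is enumerated by a monotone sequence. -/
theorem exists_monotone_enum {F : Finset ℝ} (hF : F.Nonempty) :
    ∃ u : ℕ → ℝ, Monotone u ∧ (∀ n, u n ∈ F) ∧ ∀ x ∈ F, ∃ n < F.card, u n = x := by
  have hc : 0 < F.card := hF.card_pos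
  refine ⟨fun n => F.orderEmbOfFin rfl ⟨min n (F.card - 1), by omega⟩, ?_, ?_, ?_⟩
  · intro i j hij
    simp only [OrderEmbedding.le_iff_le, Fin.mk_le_mk]
    exact min_le_min_right _ hij
  · intro n
    exact F.orderEmbOfFin_mem rfl _
  · intro x hx
    have : x ∈ range (F.orderEmbOfFin rfl) := by rw [F.range_orderEmbOfFin]; exact hx
    obtain ⟨⟨i, hi⟩, rfl⟩ := this
    exact ⟨i, hi, congrArg _ (Fin.ext (min_eq_left (Nat.le_sub_one_of_lt hi)))⟩

section LIntegral

variable {m m0 : MeasurableSpace Ω} {μ : Measure Ω}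

theorem lintegral_mul_le_of_setLIntegral_le (hm : m ≤ m0) {u v W : Ω → ℝ≥0∞} (hu : AEMeasurable u μ)
    (hv : AEMeasurable v μ)
    (h : ∀ A, MeasurableSet[m] A → ∫⁻ ω in A, u ω ∂μ ≤ ∫⁻ ω in A, v ω ∂μ)
    (hW : Measurable[m] W) : ∫⁻ ω, u ω * W ω ∂μ ≤ ∫⁻ ω, v ω * W ω ∂μ := by
  have key : ∀ w : Ω → ℝ≥0∞, AEMeasurable w μ →
      ∫⁻ ω, w ω * W ω ∂μ = ∫⁻ ω, W ω ∂((μ.withDensity w).trim hm) := by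
    intro w hw
    rw [lintegral_trim hm hW, lintegral_withDensity_eq_lintegral_mul₀ hw
      (hW.mono hm le_rfl).aemeasurable]
    rfl
  rw [key u hu, key v hv]
  refine lintegral_mono' ?_ le_rfl
  refine Measure.le_iff.2 fun A hA => ?_
  rw [trim_measurableSet_eq hm hA, trim_measurableSet_eq hm hA, withDensity_apply _ (hm A hA),
    withDensity_apply _ (hm A hA)]
  exact h A hA

theorem ae_le_of_setLIntegral_le_of_measurable [IsFiniteMeasure μ] (hm : m ≤ m0)
    {u v : Ω → ℝ≥0∞} (hu : Measurable[m] u) (hv : Measurable[m] v)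
    (h : ∀ A, MeasurableSet[m] A → ∫⁻ ω in A, u ω ∂μ ≤ ∫⁻ ω in A, v ω ∂μ) : u ≤ᵐ[μ] v := by
  refine ae_le_of_ae_le_trim (hm := hm) ?_
  refine ae_le_of_forall_setLIntegral_le_of_sigmaFinite hu fun A hA _ => ?_
  rw [setLIntegral_trim hm hu hA, setLIntegral_trim hm hv hA]
  exact h A hA

theorem setLIntegral_ofReal_condExp [IsFiniteMeasure μ] (hm : m ≤ m0) {f : Ω → ℝ}
    (hf : Integrable f μ) (h0 : 0 ≤ᵐ[μ] f) {A : Set Ω} (hA : MeasurableSet[m] A) :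
    ∫⁻ ω in A, ENNReal.ofReal ((μ[f | m]) ω) ∂μ = ∫⁻ ω in A, ENNReal.ofReal (f ω) ∂μ := by
  rw [← ofReal_integral_eq_lintegral_ofReal integrable_condExp.integrableOn
      (ae_restrict_of_ae (condExp_nonneg h0)),
    ← ofReal_integral_eq_lintegral_ofReal hf.integrableOn (ae_restrict_of_ae h0),
    setIntegral_condExp hm hf hA]

theorem condExp_le_of_setLIntegral_le [IsFiniteMeasure μ] (hm : m ≤ m0) {f g : Ω → ℝ}
    (hf : Integrable f μ) (hf0 : 0 ≤ᵐ[μ] f) (hg : StronglyMeasurable[m] g) (hg0 : 0 ≤ᵐ[μ] g)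
    (h : ∀ A, MeasurableSet[m] A →
      ∫⁻ ω in A, ENNReal.ofReal (f ω) ∂μ ≤ ∫⁻ ω in A, ENNReal.ofReal (g ω) ∂μ) :
    μ[f | m] ≤ᵐ[μ] g := by
  have := ae_le_of_setLIntegral_le_of_measurable (μ := μ) hm
    (u := fun ω => ENNReal.ofReal ((μ[f | m]) ω)) (v := fun ω => ENNReal.ofReal (g ω))
    stronglyMeasurable_condExp.measurable.ennreal_ofReal hg.measurable.ennreal_ofReal
    (fun A hA => by rw [setLIntegral_ofReal_condExp hm hf hf0 hA]; exact h A hA)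
  filter_upwards [this, hg0] with ω h1 h2
  exact (ENNReal.ofReal_le_ofReal_iff h2).1 h1

theorem setLIntegral_le_of_condExp_le [IsFiniteMeasure μ] (hm : m ≤ m0) {f g : Ω → ℝ}
    (hf : Integrable f μ) (hf0 : 0 ≤ᵐ[μ] f) (h : μ[f | m] ≤ᵐ[μ] g) {A : Set Ω}
    (hA : MeasurableSet[m] A) :
    ∫⁻ ω in A, ENNReal.ofReal (f ω) ∂μ ≤ ∫⁻ ω in A, ENNReal.ofReal (g ω) ∂μ := by
  rw [← setLIntegral_ofReal_condExp hm hf hf0 hA]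
  exact lintegral_mono_ae (ae_restrict_of_ae (h.mono fun ω hω => ENNReal.ofReal_le_ofReal hω))

theorem measurable_econd (f : Ω → ℝ) : Measurable[m] (econd μ m f) :=
  Measurable.iSup fun _ => stronglyMeasurable_condExp.measurable.ennreal_ofReal

theorem setLIntegral_econd [IsFiniteMeasure μ] (hm : m ≤ m0) {f : Ω → ℝ}
    (hf : AEStronglyMeasurable f μ) (h0 : 0 ≤ᵐ[μ] f) {A : Set Ω} (hA : MeasurableSet[m] A) :
    ∫⁻ ω in A, econd μ m f ω ∂μ = ∫⁻ ω in A, ENNReal.ofReal (f ω) ∂μ := by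
  have hint : ∀ n : ℕ, Integrable (fun ω => min (f ω) n) μ := fun n =>
    (integrable_const (n : ℝ)).mono' (hf.inf aestronglyMeasurable_const) (h0.mono fun ω hω => by
      rw [Real.norm_of_nonneg (le_min hω (Nat.cast_nonneg n))]
      exact min_le_right _ _)
  have hnn : ∀ n : ℕ, 0 ≤ᵐ[μ] fun ω => min (f ω) n := fun n =>
    h0.mono fun ω hω => le_min hω (Nat.cast_nonneg n)
  unfold econd
  rw [lintegral_iSup' (fun n => (stronglyMeasurable_condExp.measurable.ennreal_ofReal.mono hm
    le_rfl).aemeasurable)]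
  · simp_rw [fun n : ℕ => setLIntegral_ofReal_condExp hm (hint n) (hnn n) hA]
    rw [← lintegral_iSup' (fun n => (hint n).1.aemeasurable.ennreal_ofReal.restrict)]
    · refine lintegral_congr fun ω => le_antisymm
        (iSup_le fun n => ENNReal.ofReal_le_ofReal (min_le_left _ _)) ?_
      obtain ⟨n, hn⟩ := exists_nat_ge (f ω)
      exact le_iSup_of_le n (by rw [min_eq_left hn])
    · exact ae_of_all _ fun ω i j hij => ENNReal.ofReal_le_ofReal
        (min_le_min_left _ (Nat.cast_le.2 hij))
  · refine ae_restrict_of_ae ?_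
    have : ∀ᵐ ω ∂μ, ∀ n : ℕ, (μ[fun ω' => min (f ω') (n : ℝ) | m]) ω ≤
        (μ[fun ω' => min (f ω') ((n + 1 : ℕ) : ℝ) | m]) ω :=
      ae_all_iff.2 fun n => condExp_mono (hint n) (hint (n + 1)) (ae_of_all _ fun ω =>
        min_le_min_left _ (Nat.cast_le.2 n.le_succ))
    filter_upwards [this] with ω hω
    exact monotone_nat_of_le_succ fun n => ENNReal.ofReal_le_ofReal (hω n)

theorem lintegral_econd_mul [IsFiniteMeasure μ] (hm : m ≤ m0) {f : Ω → ℝ}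
    (hf : AEStronglyMeasurable f μ) (h0 : 0 ≤ᵐ[μ] f) {W : Ω → ℝ≥0∞} (hW : Measurable[m] W) :
    ∫⁻ ω, econd μ m f ω * W ω ∂μ = ∫⁻ ω, ENNReal.ofReal (f ω) * W ω ∂μ :=
  le_antisymm
    (lintegral_mul_le_of_setLIntegral_le hm ((measurable_econd f).mono hm le_rfl).aemeasurable
      hf.aemeasurable.ennreal_ofReal (fun _ hA => (setLIntegral_econd hm hf h0 hA).le) hW)
    (lintegral_mul_le_of_setLIntegral_le hm hf.aemeasurable.ennreal_ofReal
      ((measurable_econd f).mono hm le_rfl).aemeasurable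
      (fun _ hA => (setLIntegral_econd hm hf h0 hA).ge) hW)

/-- An upward directed family is integrated against any weight like its least upper bound. -/
theorem lintegral_mul_le_of_directed_esssup [IsFiniteMeasure μ] {ι : Type*} [Nonempty ι]
    {E : ι → Ω → ℝ≥0∞} (hE : ∀ i, Measurable (E i))
    (hdir : ∀ i j, ∃ k, E i ≤ᵐ[μ] E k ∧ E j ≤ᵐ[μ] E k)
    {x : Ω → ℝ≥0∞} (hx : Measurable x) (hxtop : ∀ ω, x ω ≠ ∞) (hub : ∀ i, E i ≤ᵐ[μ] x)
    (hlub : ∀ Z : Ω → ℝ≥0∞, (∀ i, E i ≤ᵐ[μ] Z) → x ≤ᵐ[μ] Z)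
    {W : Ω → ℝ≥0∞} (hW : Measurable W) {R : ℝ≥0∞} (hR : ∀ i, ∫⁻ ω, E i ω * W ω ∂μ ≤ R) :
    ∫⁻ ω, x ω * W ω ∂μ ≤ R := by
  set w : Ω → ℝ≥0∞ := fun ω => (1 + x ω)⁻¹ with hw
  have hwm : Measurable w := (measurable_const.add hx).inv
  have hw0 : ∀ ω, w ω ≠ 0 := fun ω => ENNReal.inv_ne_zero.2 (by simp [hxtop])
  have hwt : ∀ ω, w ω ≠ ∞ := fun ω => ENNReal.inv_ne_top.2 (by simp)
  set α := ⨆ i, ∫⁻ ω, E i ω * w ω ∂μ with hα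
  have hxw : ∀ ω, x ω * w ω ≤ 1 := fun ω => by
    rw [hw, ← div_eq_mul_inv]
    exact ENNReal.div_le_of_le_mul (by rw [one_mul]; exact le_add_self)
  have hαtop : α ≠ ∞ := by
    refine ne_top_of_le_ne_top (measure_ne_top μ univ) (iSup_le fun i => ?_)
    rw [← lintegral_one]
    exact lintegral_mono_ae ((hub i).mono fun ω hω => (mul_le_mul_left hω _).trans (hxw ω))
  obtain ⟨y, -, hy, hylim⟩ := exists_seq_tendsto_sSup
    (S := range fun i => ∫⁻ ω, E i ω * w ω ∂μ) (range_nonempty _) (OrderTop.bddAbove _)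
  choose j hj using hylim
  choose d hd1 hd2 using hdir
  set v : ℕ → ι := fun n => Nat.rec (j 0) (fun n i => d i (j (n + 1))) n with hv
  have hvmono : ∀ᵐ ω ∂μ, Monotone fun n => E (v n) ω := by
    filter_upwards [ae_all_iff.2 fun n => hd1 (v n) (j (n + 1))] with ω hω
    exact monotone_nat_of_le_succ hω
  have hvj : ∀ n, E (j n) ≤ᵐ[μ] E (v n) := by
    intro n
    cases n with
    | zero => exact ae_of_all _ fun ω => le_rfl
    | succ n => exact hd2 (v n) (j (n + 1))
  set Z : Ω → ℝ≥0∞ := fun ω => ⨆ n, E (v n) ω with hZ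
  have hZm : Measurable Z := Measurable.iSup fun n => hE _
  have hint : ∀ {V : Ω → ℝ≥0∞}, Measurable V →
      ∫⁻ ω, Z ω * V ω ∂μ = ⨆ n, ∫⁻ ω, E (v n) ω * V ω ∂μ := by
    intro V hV
    simp_rw [hZ, ENNReal.iSup_mul]
    exact lintegral_iSup' (fun n => ((hE _).mul hV).aemeasurable)
      (hvmono.mono fun ω hω a b hab => mul_le_mul_left (hω hab) _)
  have hZα : α ≤ ∫⁻ ω, Z ω * w ω ∂μ := by
    refine le_of_tendsto' hy fun n => ?_
    rw [← hj n, hint hwm]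
    exact le_iSup_of_le n (lintegral_mono_ae ((hvj n).mono fun ω hω => mul_le_mul_left hω _))
  have hZα' : ∫⁻ ω, Z ω * w ω ∂μ ≤ α := by
    rw [hint hwm]
    exact iSup_le fun n => le_iSup (fun i => ∫⁻ ω, E i ω * w ω ∂μ) (v n)
  have hmax : ∀ i, E i ≤ᵐ[μ] Z := by
    intro i
    have h1 : ∫⁻ ω, max (Z ω) (E i ω) * w ω ∂μ ≤ α := by
      have : ∀ ω, max (Z ω) (E i ω) * w ω = ⨆ n, max (E (v n) ω) (E i ω) * w ω := fun ω => by
        rw [← ENNReal.iSup_mul, hZ]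
        congr 1
        exact (iSup_sup (a := E i ω) (f := fun n => E (v n) ω))
      simp_rw [this]
      rw [lintegral_iSup' (f := fun n ω => max (E (v n) ω) (E i ω) * w ω)
        (fun n => (((hE _).max (hE i)).mul hwm).aemeasurable)
        (hvmono.mono fun ω hω a b hab => mul_le_mul_left (max_le_max_right _ (hω hab)) _)]
      refine iSup_le fun n => ?_
      refine le_trans ?_ (le_iSup (fun i => ∫⁻ ω, E i ω * w ω ∂μ) (d (v n) i))
      refine lintegral_mono_ae ?_
      filter_upwards [hd1 (v n) i, hd2 (v n) i] with ω h1 h2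
      exact mul_le_mul_left (max_le h1 h2) _
    have h2 : (fun ω => Z ω * w ω) =ᵐ[μ] fun ω => max (Z ω) (E i ω) * w ω :=
      ae_eq_of_ae_le_of_lintegral_le (ae_of_all _ fun ω => mul_le_mul_left (le_max_left _ _) _)
        (ne_top_of_le_ne_top hαtop hZα') ((hZm.max (hE i)).mul hwm).aemeasurable (h1.trans hZα)
    filter_upwards [h2] with ω hω
    have : Z ω = max (Z ω) (E i ω) := (ENNReal.mul_left_inj (hw0 ω) (hwt ω)).1 hω
    rw [this]
    exact le_max_right _ _
  calc ∫⁻ ω, x ω * W ω ∂μ ≤ ∫⁻ ω, Z ω * W ω ∂μ :=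
        lintegral_mono_ae ((hlub Z hmax).mono fun ω hω => mul_le_mul_left hω _)
    _ ≤ R := by rw [hint hW]; exact iSup_le fun n => hR _

end LIntegral

section Supermartingale

variable {m0 : MeasurableSpace Ω} {μ : Measure Ω} {T : ℝ} {ℱ : Filtration ℝ m0}

/-- A `[0,∞]`-valued supermartingale on `[0,T]`, not assumed integrable. -/
structure LSupermartingale (μ : Measure Ω) (T : ℝ) (ℱ : Filtration ℝ m0)
    (z : ℝ → Ω → ℝ≥0∞) : Prop where
  measurable : ∀ t ∈ Icc (0 : ℝ) T, Measurable[ℱ t] (z t)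
  setLIntegral_le : ∀ s ∈ Icc (0 : ℝ) T, ∀ t ∈ Icc (0 : ℝ) T, s ≤ t →
    ∀ A, MeasurableSet[ℱ s] A → ∫⁻ ω in A, z t ω ∂μ ≤ ∫⁻ ω in A, z s ω ∂μ

theorem SupermartProp.lsupermartingale [IsFiniteMeasure μ] {Z : ℝ → Ω → ℝ}
    (hZ : SupermartProp μ T ℱ Z) (hnn : ∀ t ∈ Icc (0 : ℝ) T, 0 ≤ᵐ[μ] Z t) :
    LSupermartingale μ T ℱ fun t ω => ENNReal.ofReal (Z t ω) where
  measurable t ht := (hZ.1 t ht).measurable.ennreal_ofReal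
  setLIntegral_le s hs t ht hst _ hA :=
    setLIntegral_le_of_condExp_le (ℱ.le s) (hZ.2.1 t ht) (hnn t ht) (hZ.2.2 s t hs ht hst) hA

theorem LSupermartingale.supermartProp [IsFiniteMeasure μ] {Z : ℝ → Ω → ℝ}
    (hz : LSupermartingale μ T ℱ fun t ω => ENNReal.ofReal (Z t ω))
    (hm : ∀ t ∈ Icc (0 : ℝ) T, StronglyMeasurable[ℱ t] (Z t))
    (hnn : ∀ t ∈ Icc (0 : ℝ) T, 0 ≤ᵐ[μ] Z t) (h0 : ∫⁻ ω, ENNReal.ofReal (Z 0 ω) ∂μ ≠ ∞) :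
    SupermartProp μ T ℱ Z := by
  have hint : ∀ t ∈ Icc (0 : ℝ) T, Integrable (Z t) μ := by
    intro t ht
    refine ⟨((hm t ht).mono (ℱ.le t)).aestronglyMeasurable, ?_⟩
    rw [hasFiniteIntegral_iff_ofReal (hnn t ht)]
    have := hz.setLIntegral_le 0 ⟨le_rfl, ht.1.trans ht.2⟩ t ht ht.1 univ MeasurableSet.univ
    simp only [Measure.restrict_univ] at this
    exact this.trans_lt h0.lt_top
  exact ⟨hm, hint, fun s t hs ht hst => condExp_le_of_setLIntegral_le (ℱ.le s) (hint t ht)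
    (hnn t ht) (hm s hs) (hnn s hs) (hz.setLIntegral_le s hs t ht hst)⟩

theorem LSupermartingale.ae_eq_zero_of_eq_zero {z : ℝ → Ω → ℝ≥0∞} (hz : LSupermartingale μ T ℱ z)
    {s t : ℝ} (hs : s ∈ Icc (0 : ℝ) T) (ht : t ∈ Icc (0 : ℝ) T) (hst : s ≤ t) :
    ∀ᵐ ω ∂μ, z s ω = 0 → z t ω = 0 := by
  have hA : MeasurableSet[ℱ s] {ω | z s ω = 0} := hz.measurable s hs (measurableSet_singleton 0)
  have h := hz.setLIntegral_le s hs t ht hst _ hA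
  rw [setLIntegral_congr_fun (g := fun _ => 0) (ℱ.le s _ hA) (fun ω hω => hω), lintegral_zero,
    nonpos_iff_eq_zero, lintegral_eq_zero_iff ((hz.measurable t ht).mono (ℱ.le t) le_rfl)] at h
  exact (ae_restrict_iff' (ℱ.le s _ hA)).1 h

theorem LSupermartingale.mul_measure_exists_ge_le {z : ℝ → Ω → ℝ≥0∞}
    (hz : LSupermartingale μ T ℱ z) (c : ℝ≥0∞) (F : Finset ℝ) :
    ∀ x ∈ Icc (0 : ℝ) T, (∀ y ∈ F, y ∈ Icc x T) → ∀ A, MeasurableSet[ℱ x] A →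
      c * μ (A ∩ {ω | ∃ y ∈ F, c ≤ z y ω}) ≤ ∫⁻ ω in A, z x ω ∂μ := by
  induction F using Finset.induction_on_min with
  | empty => intro x _ _ A _; simp
  | insert a F ha ih =>
    intro x hx hF A hA
    have hax : a ∈ Icc x T := hF a (Finset.mem_insert_self _ _)
    have ha0 : a ∈ Icc (0 : ℝ) T := ⟨hx.1.trans hax.1, hax.2⟩
    have hA' : MeasurableSet[ℱ a] A := ℱ.mono hax.1 _ hA
    have hB : MeasurableSet[ℱ a] {ω | c ≤ z a ω} :=
      measurableSet_le measurable_const (hz.measurable a ha0)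
    have ih' := ih a ha0 (fun y hy => ⟨(ha y hy).le, (hF y (Finset.mem_insert_of_mem hy)).2⟩)
      (A \ {ω | c ≤ z a ω}) (hA'.diff hB)
    have hsub : A ∩ {ω | ∃ y ∈ insert a F, c ≤ z y ω} ⊆ (A ∩ {ω | c ≤ z a ω}) ∪
        ((A \ {ω | c ≤ z a ω}) ∩ {ω | ∃ y ∈ F, c ≤ z y ω}) := by
      rintro ω ⟨hωA, y, hy, hc⟩
      by_cases h : c ≤ z a ω
      · exact Or.inl ⟨hωA, h⟩
      · rcases Finset.mem_insert.1 hy with rfl | hy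
        · exact absurd hc h
        · exact Or.inr ⟨⟨hωA, h⟩, y, hy, hc⟩
    have h1 : c * μ (A ∩ {ω | c ≤ z a ω}) ≤ ∫⁻ ω in A ∩ {ω | c ≤ z a ω}, z a ω ∂μ := by
      rw [← setLIntegral_const]
      exact setLIntegral_mono' (ℱ.le a _ (hA'.inter hB)) fun ω hω => hω.2
    calc c * μ (A ∩ {ω | ∃ y ∈ insert a F, c ≤ z y ω})
        ≤ c * μ (A ∩ {ω | c ≤ z a ω}) +
          c * μ ((A \ {ω | c ≤ z a ω}) ∩ {ω | ∃ y ∈ F, c ≤ z y ω}) := by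
          rw [← mul_add]
          exact mul_le_mul_right ((measure_mono hsub).trans (measure_union_le _ _)) _
      _ ≤ ∫⁻ ω in A ∩ {ω | c ≤ z a ω}, z a ω ∂μ + ∫⁻ ω in A \ {ω | c ≤ z a ω}, z a ω ∂μ :=
          add_le_add h1 ih'
      _ = ∫⁻ ω in A, z a ω ∂μ := lintegral_inter_add_sdiff _ _ (ℱ.le a _ hB)
      _ ≤ ∫⁻ ω in A, z x ω ∂μ := hz.setLIntegral_le x hx a ha0 hax.1 A hA

theorem LSupermartingale.setLIntegral_exists_le_le {z : ℝ → Ω → ℝ≥0∞} (hT : 0 ≤ T)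
    (hz : LSupermartingale μ T ℱ z) (c : ℝ≥0∞) (F : Finset ℝ) :
    ∀ x ∈ Icc (0 : ℝ) T, (∀ y ∈ F, y ∈ Icc x T) → ∀ A, MeasurableSet[ℱ x] A →
      μ.withDensity (z T) (A ∩ {ω | ∃ y ∈ F, z y ω ≤ c}) ≤ c * μ A := by
  induction F using Finset.induction_on_min with
  | empty => intro x _ _ A _; simp
  | insert a F ha ih =>
    intro x hx hF A hA
    have hax : a ∈ Icc x T := hF a (Finset.mem_insert_self _ _)
    have ha0 : a ∈ Icc (0 : ℝ) T := ⟨hx.1.trans hax.1, hax.2⟩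
    have hA' : MeasurableSet[ℱ a] A := ℱ.mono hax.1 _ hA
    have hB : MeasurableSet[ℱ a] {ω | z a ω ≤ c} :=
      measurableSet_le (hz.measurable a ha0) measurable_const
    have ih' := ih a ha0 (fun y hy => ⟨(ha y hy).le, (hF y (Finset.mem_insert_of_mem hy)).2⟩)
      (A \ {ω | z a ω ≤ c}) (hA'.diff hB)
    have hsub : A ∩ {ω | ∃ y ∈ insert a F, z y ω ≤ c} ⊆ (A ∩ {ω | z a ω ≤ c}) ∪
        ((A \ {ω | z a ω ≤ c}) ∩ {ω | ∃ y ∈ F, z y ω ≤ c}) := by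
      rintro ω ⟨hωA, y, hy, hc⟩
      by_cases h : z a ω ≤ c
      · exact Or.inl ⟨hωA, h⟩
      · rcases Finset.mem_insert.1 hy with rfl | hy
        · exact absurd hc h
        · exact Or.inr ⟨⟨hωA, h⟩, y, hy, hc⟩
    have h1 : μ.withDensity (z T) (A ∩ {ω | z a ω ≤ c}) ≤ c * μ (A ∩ {ω | z a ω ≤ c}) := by
      rw [withDensity_apply _ (ℱ.le a _ (hA'.inter hB)), ← setLIntegral_const]
      exact (hz.setLIntegral_le a ha0 T ⟨hT, le_rfl⟩ ha0.2 _ (hA'.inter hB)).trans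
        (setLIntegral_mono' (ℱ.le a _ (hA'.inter hB)) fun ω hω => hω.2)
    calc μ.withDensity (z T) (A ∩ {ω | ∃ y ∈ insert a F, z y ω ≤ c})
        ≤ μ.withDensity (z T) (A ∩ {ω | z a ω ≤ c}) +
          μ.withDensity (z T) ((A \ {ω | z a ω ≤ c}) ∩ {ω | ∃ y ∈ F, z y ω ≤ c}) :=
          (measure_mono hsub).trans (measure_union_le _ _)
      _ ≤ c * μ (A ∩ {ω | z a ω ≤ c}) + c * μ (A \ {ω | z a ω ≤ c}) := add_le_add h1 ih'
      _ = c * μ A := by rw [← mul_add, measure_inter_add_sdiff _ (ℱ.le a _ hB)]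

theorem exists_finset_exhaustion {D : Set ℝ} (hD : D.Countable) (hne : D.Nonempty) :
    ∃ F : ℕ → Finset ℝ, Monotone (fun n => (F n : Set ℝ)) ∧ (∀ n, (F n).Nonempty) ∧
      ⋃ n, (F n : Set ℝ) = D := by
  obtain ⟨d, rfl⟩ := hD.exists_eq_range hne
  refine ⟨fun n => (Finset.range (n + 1)).image d, ?_, fun n => by simp, ?_⟩
  · intro i j hij
    exact Finset.coe_subset.2 (Finset.image_subset_image (by simpa using hij))
  · ext x
    simp only [Finset.coe_image, mem_iUnion, mem_image, mem_range]
    exact ⟨fun ⟨_, i, _, h⟩ => ⟨i, h⟩, fun ⟨i, h⟩ => ⟨i, i, by simp, h⟩⟩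

theorem LSupermartingale.ae_bounded [IsFiniteMeasure μ] {z : ℝ → Ω → ℝ≥0∞} (hT : 0 ≤ T)
    (hz : LSupermartingale μ T ℱ z) (h0 : ∫⁻ ω, z 0 ω ∂μ ≠ ∞) {D : Set ℝ} (hD : D.Countable)
    (hDT : D ⊆ Icc 0 T) : ∀ᵐ ω ∂μ, ∃ K : ℕ, ∀ s ∈ D, z s ω < K := by
  rcases D.eq_empty_or_nonempty with rfl | hne
  · exact ae_of_all _ fun ω => ⟨0, by simp⟩
  obtain ⟨F, hFm, -, rfl⟩ := exists_finset_exhaustion hD hne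
  have h1 : ∀ n : ℕ, (n : ℝ≥0∞) * μ {ω | ∃ y ∈ ⋃ i, (F i : Set ℝ), n ≤ z y ω}
      ≤ ∫⁻ ω, z 0 ω ∂μ := by
    intro n
    have : {ω | ∃ y ∈ ⋃ i, (F i : Set ℝ), n ≤ z y ω} = ⋃ i, {ω | ∃ y ∈ F i, n ≤ z y ω} := by
      ext ω; simp only [mem_iUnion, mem_ofPred_eq, Finset.mem_coe]
      exact ⟨fun ⟨y, ⟨i, hi⟩, h⟩ => ⟨i, y, hi, h⟩, fun ⟨i, y, hi, h⟩ => ⟨y, ⟨i, hi⟩, h⟩⟩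
    have hmono : Monotone fun i => {ω | ∃ y ∈ F i, n ≤ z y ω} :=
      fun i j hij ω ⟨y, hy, h⟩ => ⟨y, hFm hij hy, h⟩
    rw [this, hmono.measure_iUnion, ENNReal.mul_iSup]
    refine iSup_le fun i => ?_
    have := hz.mul_measure_exists_ge_le n (F i) 0 ⟨le_rfl, hT⟩
      (fun y hy => hDT (mem_iUnion.2 ⟨i, hy⟩)) univ MeasurableSet.univ
    simpa using this
  have h2 : μ {ω | ∀ n : ℕ, ∃ y ∈ ⋃ i, (F i : Set ℝ), n ≤ z y ω} = 0 := by
    by_contra hne0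
    have h3 : ∀ n : ℕ, (n : ℝ≥0∞) ≤ (∫⁻ ω, z 0 ω ∂μ) /
        μ {ω | ∀ n : ℕ, ∃ y ∈ ⋃ i, (F i : Set ℝ), n ≤ z y ω} := fun n => by
      rw [ENNReal.le_div_iff_mul_le (Or.inl hne0) (Or.inl (measure_ne_top _ _))]
      have hsub : {ω | ∀ n : ℕ, ∃ y ∈ ⋃ i, (F i : Set ℝ), n ≤ z y ω} ⊆
          {ω | ∃ y ∈ ⋃ i, (F i : Set ℝ), n ≤ z y ω} := fun ω hω => hω n
      exact (mul_le_mul_right (measure_mono hsub) _).trans (h1 n)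
    have h4 := ENNReal.div_ne_top h0 hne0
    obtain ⟨n, hn⟩ := ENNReal.exists_nat_gt h4
    exact absurd (h3 n) (not_le.2 hn)
  filter_upwards [measure_eq_zero_iff_ae_notMem.1 h2] with ω hω
  simp only [not_forall, not_exists, not_and, not_le] at hω
  exact hω

theorem LSupermartingale.ae_bounded_below [IsFiniteMeasure μ] {z : ℝ → Ω → ℝ≥0∞} (hT : 0 ≤ T)
    (hz : LSupermartingale μ T ℱ z) {D : Set ℝ} (hD : D.Countable)
    (hDT : D ⊆ Icc 0 T) :
    ∀ᵐ ω ∂μ, z T ω ≠ 0 → ∃ n : ℕ, ∀ s ∈ D, (n : ℝ≥0∞)⁻¹ < z s ω := by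
  rcases D.eq_empty_or_nonempty with rfl | hne
  · exact ae_of_all _ fun ω _ => ⟨0, by simp⟩
  obtain ⟨F, hFm, -, rfl⟩ := exists_finset_exhaustion hD hne
  rw [← ae_withDensity_iff ((hz.measurable T ⟨hT, le_rfl⟩).mono (ℱ.le T) le_rfl)]
  have h1 : ∀ n : ℕ, μ.withDensity (z T) {ω | ∃ y ∈ ⋃ i, (F i : Set ℝ), z y ω ≤ (n : ℝ≥0∞)⁻¹}
      ≤ (n : ℝ≥0∞)⁻¹ * μ univ := by
    intro n
    have : {ω | ∃ y ∈ ⋃ i, (F i : Set ℝ), z y ω ≤ (n : ℝ≥0∞)⁻¹} =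
        ⋃ i, {ω | ∃ y ∈ F i, z y ω ≤ (n : ℝ≥0∞)⁻¹} := by
      ext ω; simp only [mem_iUnion, mem_ofPred_eq, Finset.mem_coe]
      exact ⟨fun ⟨y, ⟨i, hi⟩, h⟩ => ⟨i, y, hi, h⟩, fun ⟨i, y, hi, h⟩ => ⟨y, ⟨i, hi⟩, h⟩⟩
    have hmono : Monotone fun i => {ω | ∃ y ∈ F i, z y ω ≤ (n : ℝ≥0∞)⁻¹} :=
      fun i j hij ω ⟨y, hy, h⟩ => ⟨y, hFm hij hy, h⟩
    rw [this, hmono.measure_iUnion]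
    refine iSup_le fun i => ?_
    have := hz.setLIntegral_exists_le_le hT (n : ℝ≥0∞)⁻¹ (F i) 0 ⟨le_rfl, hT⟩
      (fun y hy => hDT (mem_iUnion.2 ⟨i, hy⟩)) univ MeasurableSet.univ
    simpa using this
  have h2 : μ.withDensity (z T)
      {ω | ∀ n : ℕ, ∃ y ∈ ⋃ i, (F i : Set ℝ), z y ω ≤ (n : ℝ≥0∞)⁻¹} = 0 := by
    have hlim : Tendsto (fun n : ℕ => (n : ℝ≥0∞)⁻¹ * μ univ) atTop (𝓝 (0 * μ univ)) :=
      ENNReal.Tendsto.mul_const ENNReal.tendsto_inv_nat_nhds_zero (Or.inr (measure_ne_top _ _))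
    rw [zero_mul] at hlim
    refine nonpos_iff_eq_zero.1 (ge_of_tendsto' hlim fun n => ?_)
    have hsub : {ω | ∀ n : ℕ, ∃ y ∈ ⋃ i, (F i : Set ℝ), z y ω ≤ (n : ℝ≥0∞)⁻¹} ⊆
        {ω | ∃ y ∈ ⋃ i, (F i : Set ℝ), z y ω ≤ (n : ℝ≥0∞)⁻¹} := fun ω hω => hω n
    exact (measure_mono hsub).trans (h1 n)
  filter_upwards [measure_eq_zero_iff_ae_notMem.1 h2] with ω hω
  simp only [not_forall, not_exists, not_and, not_le] at hω
  exact hω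

theorem SupermartProp.mul_measure_hasUpcrossings_le [IsProbabilityMeasure μ] {Z : ℝ → Ω → ℝ}
    (hZ : SupermartProp μ T ℱ Z) (hnn : ∀ t ∈ Icc (0 : ℝ) T, 0 ≤ᵐ[μ] Z t) {F : Finset ℝ}
    (hF : F.Nonempty) (hFT : (F : Set ℝ) ⊆ Icc 0 T) {a b : ℝ} (hab : a < b) (k : ℕ) (x : ℝ) :
    (k : ℝ≥0∞) * μ {ω | HasUpcrossings F (fun t => -Z t ω) a b k x} ≤
      ENNReal.ofReal (|a| / (b - a)) := by
  obtain ⟨u, hu, huF, hFu⟩ := exists_monotone_enum hF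
  let 𝒢 : Filtration ℕ m0 := ⟨fun n => ℱ (u n), fun i j hij => ℱ.mono (hu hij), fun n => ℱ.le _⟩
  have hsub : Submartingale (fun n => -Z (u n)) 𝒢 μ := by
    have : Supermartingale (fun n => Z (u n)) 𝒢 μ :=
      ⟨fun n => hZ.1 _ (hFT (huF n)),
        fun i j hij => hZ.2.2 _ _ (hFT (huF i)) (hFT (huF j)) (hu hij),
        fun n => hZ.2.1 _ (hFT (huF n))⟩
    exact this.neg
  set U := upcrossingsBefore a b (fun n => -Z (u n)) F.card with hU
  have hUint : Integrable (fun ω => (U ω : ℝ)) μ :=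
    hsub.stronglyAdapted.integrable_upcrossingsBefore hab
  have h1 : (b - a) * ∫ ω, (U ω : ℝ) ∂μ ≤ |a| := by
    refine (hsub.mul_integral_upcrossingsBefore_le_integral_pos_part a b F.card).trans ?_
    calc ∫ ω, ((-Z (u F.card)) ω - a)⁺ ∂μ ≤ ∫ _, |a| ∂μ := by
          refine integral_mono_of_nonneg (ae_of_all _ fun ω => posPart_nonneg _)
            (integrable_const _) ?_
          filter_upwards [hnn _ (hFT (huF F.card))] with ω hω
          have : 0 ≤ Z (u F.card) ω := hω
          refine sup_le ?_ (abs_nonneg _)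
          simp only [Pi.neg_apply]
          linarith [neg_abs_le a]
      _ = |a| := by simp
  calc (k : ℝ≥0∞) * μ {ω | HasUpcrossings F (fun t => -Z t ω) a b k x}
      ≤ (k : ℝ≥0∞) * μ {ω | (k : ℝ≥0∞) ≤ ENNReal.ofReal (U ω)} := by
        refine mul_le_mul_right (measure_mono fun ω hω => ?_) _
        have := le_upcrossingsBefore_of_hasUpcrossings (S := fun t => -Z t) hu hFu hab hω
        simp only [mem_ofPred_eq, ENNReal.ofReal_natCast]
        exact_mod_cast this
    _ ≤ ∫⁻ ω, ENNReal.ofReal (U ω) ∂μ :=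
        mul_meas_ge_le_lintegral₀ hUint.1.aemeasurable.ennreal_ofReal _
    _ = ENNReal.ofReal (∫ ω, (U ω : ℝ) ∂μ) :=
        (ofReal_integral_eq_lintegral_ofReal hUint (ae_of_all _ fun ω => Nat.cast_nonneg _)).symm
    _ ≤ ENNReal.ofReal (|a| / (b - a)) := by
        refine ENNReal.ofReal_le_ofReal ?_
        rw [le_div_iff₀ (sub_pos.2 hab), mul_comm]
        exact h1

/-- Doob regularisation: a nonnegative supermartingale has one-sided limits along a countable
set of times. -/
theorem SupermartProp.ae_exists_tendsto [IsProbabilityMeasure μ] {Z : ℝ → Ω → ℝ} (hT : 0 ≤ T)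
    (hZ : SupermartProp μ T ℱ Z) (hnn : ∀ t ∈ Icc (0 : ℝ) T, 0 ≤ᵐ[μ] Z t) {D : Set ℝ}
    (hD : D.Countable) (hDT : D ⊆ Icc 0 T) :
    ∀ᵐ ω ∂μ, (∀ t, 0 ≤ t → ∃ L, Tendsto (fun s => Z s ω) (𝓝[D ∩ Ioi t] t) (𝓝 L)) ∧
      ∀ t, 0 < t → ∃ L, Tendsto (fun s => Z s ω) (𝓝[D ∩ Iio t] t) (𝓝 L) := by
  rcases D.eq_empty_or_nonempty with rfl | hne
  · exact ae_of_all _ fun ω => by simp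
  have hz := hZ.lsupermartingale hnn
  have hbd := hz.ae_bounded hT ((hasFiniteIntegral_iff_ofReal
    (hnn 0 ⟨le_rfl, hT⟩)).1 (hZ.2.1 0 ⟨le_rfl, hT⟩).2).ne hD hDT
  have hnnD : ∀ᵐ ω ∂μ, ∀ s ∈ D, 0 ≤ Z s ω :=
    (ae_ball_iff hD).2 fun s hs => hnn s (hDT hs)
  have hup : ∀ᵐ ω ∂μ, ∀ a b : ℚ, (a : ℝ) < b →
      ∃ k, ¬ HasUpcrossings D (fun t => -Z t ω) a b k 0 := by
    rw [ae_all_iff]; intro a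
    rw [ae_all_iff]; intro b
    by_cases hab : (a : ℝ) < b
    swap
    · exact ae_of_all _ fun ω h => absurd h hab
    obtain ⟨F, hFm, hFne, rfl⟩ := exists_finset_exhaustion hD hne
    have h1 : ∀ k : ℕ, (k : ℝ≥0∞) *
        μ {ω | HasUpcrossings (⋃ n, (F n : Set ℝ)) (fun t => -Z t ω) a b k 0} ≤
        ENNReal.ofReal (|(a : ℝ)| / (b - a)) := by
      intro k
      have : {ω | HasUpcrossings (⋃ n, (F n : Set ℝ)) (fun t => -Z t ω) a b k 0} ⊆
          ⋃ n, {ω | HasUpcrossings (F n : Set ℝ) (fun t => -Z t ω) a b k 0} := fun ω hω =>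
        mem_iUnion.2 (HasUpcrossings.exists_of_iUnion hFm hω)
      refine (mul_le_mul_right (measure_mono this) _).trans ?_
      have hmono : Monotone fun n =>
          {ω | HasUpcrossings (F n : Set ℝ) (fun t => -Z t ω) a b k 0} :=
        fun i j hij ω h => HasUpcrossings.mono_set (hFm hij) h
      rw [hmono.measure_iUnion, ENNReal.mul_iSup]
      exact iSup_le fun n => hZ.mul_measure_hasUpcrossings_le hnn (hFne n)
        ((subset_iUnion (fun n => (F n : Set ℝ)) n).trans hDT) hab k 0
    have h2 : μ {ω | ∀ k, HasUpcrossings (⋃ n, (F n : Set ℝ)) (fun t => -Z t ω) a b k 0} = 0 := by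
      by_contra hne0
      obtain ⟨k, hk⟩ := ENNReal.exists_nat_gt
        (ENNReal.div_ne_top (ENNReal.ofReal_ne_top (r := |(a : ℝ)| / (b - a))) hne0)
      refine absurd ?_ (not_le.2 hk)
      rw [ENNReal.le_div_iff_mul_le (Or.inl hne0) (Or.inl (measure_ne_top _ _))]
      have hsub : {ω | ∀ k, HasUpcrossings (⋃ n, (F n : Set ℝ)) (fun t => -Z t ω) a b k 0} ⊆
          {ω | HasUpcrossings (⋃ n, (F n : Set ℝ)) (fun t => -Z t ω) a b k 0} := fun ω hω => hω k
      exact (mul_le_mul_right (measure_mono hsub) _).trans (h1 k)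
    filter_upwards [measure_eq_zero_iff_ae_notMem.1 h2] with ω hω _
    simpa using hω
  filter_upwards [hbd, hnnD, hup] with ω ⟨K, hK⟩ h0 hω
  have hb : ∀ s ∈ D, |-Z s ω| ≤ K := by
    intro s hs
    rw [abs_neg, abs_of_nonneg (h0 s hs)]
    have := (hK s hs).le
    rwa [ENNReal.ofReal_le_natCast] at this
  obtain ⟨hr, hl⟩ := exists_tendsto_of_not_hasUpcrossings hb hω
  refine ⟨fun t ht => ?_, fun t ht => ?_⟩
  · obtain ⟨L, hL⟩ := hr t ht
    exact ⟨-L, by simpa using hL.neg⟩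
  · obtain ⟨L, hL⟩ := hl t ht
    exact ⟨-L, by simpa using hL.neg⟩

end Supermartingale

section EssSup

theorem ae_econd_eq_of_ae_eq_on {m m0 : MeasurableSpace Ω} {μ : Measure Ω}
    [IsFiniteMeasure μ] (hm : m ≤ m0)
    {f f' : Ω → ℝ} (hf : AEStronglyMeasurable f μ) (h0 : 0 ≤ᵐ[μ] f)
    (hf' : AEStronglyMeasurable f' μ) (h0' : 0 ≤ᵐ[μ] f') {A : Set Ω} (hA : MeasurableSet[m] A)
    (h : ∀ᵐ ω ∂μ, ω ∈ A → f ω = f' ω) : ∀ᵐ ω ∂μ, ω ∈ A → econd μ m f ω ≤ econd μ m f' ω := by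
  have := ae_le_of_setLIntegral_le_of_measurable (μ := μ) hm
    ((measurable_econd (μ := μ) (m := m) f).indicator hA)
    ((measurable_econd (μ := μ) (m := m) f').indicator hA) (fun B hB => by
      rw [setLIntegral_indicator (hm _ hA), setLIntegral_indicator (hm _ hA),
        setLIntegral_econd hm hf h0 (hA.inter hB), setLIntegral_econd hm hf' h0' (hA.inter hB)]
      refine (lintegral_congr_ae ?_).le
      rw [Filter.EventuallyEq, ae_restrict_iff' (hm _ (hA.inter hB))]
      filter_upwards [h] with ω hω hωAB
      rw [hω hωAB.1])
  filter_upwards [this] with ω hω hωA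
  simpa [hωA] using hω

variable {m0 : MeasurableSpace Ω} {μ : Measure Ω} {T : ℝ} {ℱ : Filtration ℝ m0}

theorem SuperMG.supermartProp {Y : ℝ → Ω → ℝ} (hY : SuperMG μ T ℱ Y) : SupermartProp μ T ℱ Y :=
  ⟨hY.1.1, hY.2.1, hY.2.2⟩

theorem PosProc.ae_nonneg {Y : ℝ → Ω → ℝ} (hY : PosProc μ T ℱ Y) {t : ℝ} (ht : t ∈ Icc (0 : ℝ) T) :
    0 ≤ᵐ[μ] Y t := hY.2.1.mono fun _ h => h t ht

theorem SuperMG.lsupermartingale [IsFiniteMeasure μ] {Y : ℝ → Ω → ℝ} (hY : SuperMG μ T ℱ Y) :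
    LSupermartingale μ T ℱ fun t ω => ENNReal.ofReal (Y t ω) :=
  hY.supermartProp.lsupermartingale fun _ ht => hY.1.ae_nonneg ht

theorem SuperMG.ae_eq_zero_of_eq_zero [IsFiniteMeasure μ] {Y : ℝ → Ω → ℝ} (hY : SuperMG μ T ℱ Y)
    {s t : ℝ} (hs : s ∈ Icc (0 : ℝ) T) (ht : t ∈ Icc (0 : ℝ) T) (hst : s ≤ t) :
    ∀ᵐ ω ∂μ, Y s ω = 0 → Y t ω = 0 := by
  filter_upwards [hY.lsupermartingale.ae_eq_zero_of_eq_zero hs ht hst, hY.1.ae_nonneg ht]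
    with ω h hn h0
  exact le_antisymm (ENNReal.ofReal_eq_zero.1 (h (by simp [h0]))) hn

theorem SuperMG.ae_pos [IsFiniteMeasure μ] {Y : ℝ → Ω → ℝ} (hY : SuperMG μ T ℱ Y)
    (hpos : ∀ᵐ ω ∂μ, 0 < Y T ω) {t : ℝ} (ht : t ∈ Icc (0 : ℝ) T) : ∀ᵐ ω ∂μ, 0 < Y t ω := by
  filter_upwards [hY.ae_eq_zero_of_eq_zero ht ⟨ht.1.trans ht.2, le_rfl⟩ ht.2, hpos,
    hY.1.ae_nonneg ht] with ω h hp hn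
  exact lt_of_le_of_ne hn fun h0 => hp.ne' (h h0.symm)

theorem SuperMG.aestronglyMeasurable {Y : ℝ → Ω → ℝ} (hY : SuperMG μ T ℱ Y)
    {t : ℝ} (ht : t ∈ Icc (0 : ℝ) T) : AEStronglyMeasurable (Y t) μ :=
  ((hY.1.1 t ht).mono (ℱ.le t)).aestronglyMeasurable

theorem SuperMG.aestronglyMeasurable_mul_div {Y : ℝ → Ω → ℝ} (hY : SuperMG μ T ℱ Y) {g : Ω → ℝ}
    (hg : AEStronglyMeasurable g μ) {s t : ℝ} (hs : s ∈ Icc (0 : ℝ) T) (ht : t ∈ Icc (0 : ℝ) T) :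
    AEStronglyMeasurable (fun ω => g ω * (Y t ω / Y s ω)) μ :=
  hg.mul ((hY.aestronglyMeasurable ht).aemeasurable.div
    (hY.aestronglyMeasurable hs).aemeasurable).aestronglyMeasurable

theorem SuperMG.mul_div_nonneg {Y : ℝ → Ω → ℝ} (hY : SuperMG μ T ℱ Y) {g : Ω → ℝ}
    (hg : ∀ ω, 0 ≤ g ω) {s t : ℝ} (hs : s ∈ Icc (0 : ℝ) T) (ht : t ∈ Icc (0 : ℝ) T) :
    0 ≤ᵐ[μ] fun ω => g ω * (Y t ω / Y s ω) := by
  filter_upwards [hY.1.ae_nonneg hs, hY.1.ae_nonneg ht] with ω h1 h2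
  exact mul_nonneg (hg ω) (div_nonneg h2 h1)

theorem SuperMG.lintegral_econd_mul_mul [IsFiniteMeasure μ] {Y : ℝ → Ω → ℝ} (hY : SuperMG μ T ℱ Y)
    {g : Ω → ℝ} (hg : AEStronglyMeasurable g μ) (hg0 : ∀ ω, 0 ≤ g ω) {s t : ℝ}
    (hs : s ∈ Icc (0 : ℝ) T) (ht : t ∈ Icc (0 : ℝ) T) (hst : s ≤ t) {W : Ω → ℝ≥0∞}
    (hW : Measurable[ℱ s] W) :
    ∫⁻ ω, econd μ (ℱ s) (fun ω => g ω * (Y t ω / Y s ω)) ω * (ENNReal.ofReal (Y s ω) * W ω) ∂μ =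
      ∫⁻ ω, ENNReal.ofReal (g ω * Y t ω) * W ω ∂μ := by
  have hYW : Measurable[ℱ s] fun ω => ENNReal.ofReal (Y s ω) * W ω :=
    (hY.1.1 s hs).measurable.ennreal_ofReal.mul hW
  rw [lintegral_econd_mul (ℱ.le s) (hY.aestronglyMeasurable_mul_div hg hs ht)
    (hY.mul_div_nonneg hg0 hs ht) hYW]
  refine lintegral_congr_ae ?_
  filter_upwards [hY.ae_eq_zero_of_eq_zero hs ht hst, hY.1.ae_nonneg hs, hY.1.ae_nonneg ht]
    with ω h hs0 ht0
  rw [← mul_assoc, ← ENNReal.ofReal_mul (mul_nonneg (hg0 ω) (div_nonneg ht0 hs0)), mul_assoc,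
    div_mul_cancel_of_imp h]

theorem ForkConvex.concat_mem {C : Set (ℝ → Ω → ℝ)} (hC : ForkConvex μ T ℱ C) {s : ℝ}
    (hs : s ∈ Icc (0 : ℝ) T) {Y Y' : ℝ → Ω → ℝ} (hY : Y ∈ C) (hY' : Y' ∈ C) :
    (fun t ω => if t < s then Y t ω else Y s ω * (Y' t ω / Y' s ω)) ∈ C := by
  have := hC s hs (fun _ => 1) stronglyMeasurable_const (fun _ => zero_le_one) (fun _ => le_rfl)
    Y hY Y' hY' Y' hY'
  simpa using this

/-- `X` is the process equal to `1` before `t₁`, to `esssup_{Y ∈ C} E[g Y_{t₂} / Y_t | F_t]` on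
`[t₁, t₂)` and to `g` afterwards, for a far-reaching fork-convex set `C` and a claim `g` whose
essential supremum at time `t₁` is at most `1`. -/
structure IsEssSupProcess (μ : Measure Ω) (T : ℝ) (ℱ : Filtration ℝ m0) (C : Set (ℝ → Ω → ℝ))
    (t₁ t₂ : ℝ) (g : Ω → ℝ) (X : ℝ → Ω → ℝ) : Prop where
  superMG : ∀ Y ∈ C, SuperMG μ T ℱ Y
  forkConvex : ForkConvex μ T ℱ C
  farReaching : FarReaching μ T C
  left_mem : t₁ ∈ Icc (0 : ℝ) T
  right_mem : t₂ ∈ Icc (0 : ℝ) T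
  left_le_right : t₁ ≤ t₂
  stronglyMeasurable_claim : StronglyMeasurable[ℱ t₂] g
  claim_nonneg : ∀ ω, 0 ≤ g ω
  stronglyMeasurable : ∀ t ∈ Icc (0 : ℝ) T, StronglyMeasurable[ℱ t] (X t)
  nonneg : ∀ t ω, 0 ≤ X t ω
  eq_one : ∀ t, t < t₁ → ∀ ω, X t ω = 1
  eq_claim : ∀ t, t₂ ≤ t → ∀ ω, X t ω = g ω
  upper : ∀ t ∈ Ico t₁ t₂, ∀ Y ∈ C,
    econd μ (ℱ t) (fun ω => g ω * (Y t₂ ω / Y t ω)) ≤ᵐ[μ] fun ω => ENNReal.ofReal (X t ω)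
  least : ∀ t ∈ Ico t₁ t₂, ∀ Z : Ω → ℝ≥0∞,
    (∀ Y ∈ C, econd μ (ℱ t) (fun ω => g ω * (Y t₂ ω / Y t ω)) ≤ᵐ[μ] Z) →
      (fun ω => ENNReal.ofReal (X t ω)) ≤ᵐ[μ] Z
  bound : ∀ Y ∈ C,
    econd μ (ℱ t₁) (fun ω => g ω * (Y t₂ ω / Y t₁ ω)) ≤ᵐ[μ] fun _ => (1 : ℝ≥0∞)

namespace IsEssSupProcess

variable {C : Set (ℝ → Ω → ℝ)} {t₁ t₂ : ℝ} {g : Ω → ℝ} {X : ℝ → Ω → ℝ}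

theorem mem_Icc (h : IsEssSupProcess μ T ℱ C t₁ t₂ g X) {t : ℝ} (ht : t ∈ Icc t₁ t₂) :
    t ∈ Icc (0 : ℝ) T := ⟨h.left_mem.1.trans ht.1, ht.2.trans h.right_mem.2⟩

theorem aestronglyMeasurable_claim (h : IsEssSupProcess μ T ℱ C t₁ t₂ g X) :
    AEStronglyMeasurable g μ :=
  (h.stronglyMeasurable_claim.mono (ℱ.le t₂)).aestronglyMeasurable

theorem directed [IsFiniteMeasure μ] (h : IsEssSupProcess μ T ℱ C t₁ t₂ g X) {t : ℝ}
    (ht : t ∈ Ico t₁ t₂) {Y Y' : ℝ → Ω → ℝ} (hY : Y ∈ C) (hY' : Y' ∈ C) :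
    ∃ V ∈ C,
      econd μ (ℱ t) (fun ω => g ω * (Y t₂ ω / Y t ω)) ≤ᵐ[μ]
        econd μ (ℱ t) (fun ω => g ω * (V t₂ ω / V t ω)) ∧
      econd μ (ℱ t) (fun ω => g ω * (Y' t₂ ω / Y' t ω)) ≤ᵐ[μ]
        econd μ (ℱ t) (fun ω => g ω * (V t₂ ω / V t ω)) := by
  classical
  obtain ⟨Y₀, hY₀, hpos⟩ := h.farReaching
  have htI := h.mem_Icc (Ico_subset_Icc_self ht)
  set E : (ℝ → Ω → ℝ) → Ω → ℝ≥0∞ := fun Y => econd μ (ℱ t) (fun ω => g ω * (Y t₂ ω / Y t ω))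
    with hE
  have hEm : ∀ Y, Measurable[ℱ t] (E Y) := fun Y => measurable_econd _
  set A : Set Ω := {ω | E Y' ω ≤ E Y ω} with hAdef
  have hA : MeasurableSet[ℱ t] A := measurableSet_le (hEm Y') (hEm Y)
  have hV := h.forkConvex t htI (A.indicator fun _ => 1)
    (stronglyMeasurable_const.indicator hA) (fun ω => indicator_nonneg (fun _ _ => zero_le_one) ω)
    (fun ω => indicator_le_self' (fun _ _ => zero_le_one) ω) Y₀ hY₀ Y hY Y' hY'
  set V : ℝ → Ω → ℝ := fun r ω => if r < t then Y₀ r ω else Y₀ t ω *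
    (A.indicator (fun _ => 1) ω * (Y r ω / Y t ω) +
      (1 - A.indicator (fun _ => 1) ω) * (Y' r ω / Y' t ω)) with hVdef
  have key : ∀ U ∈ C, ∀ B, MeasurableSet[ℱ t] B →
      (∀ ω ∈ B, ∀ r, t ≤ r → V r ω = Y₀ t ω * (U r ω / U t ω)) →
      ∀ᵐ ω ∂μ, ω ∈ B → E U ω ≤ E V ω := by
    intro U hU B hB hBV
    refine ae_econd_eq_of_ae_eq_on (ℱ.le t)
      ((h.superMG U hU).aestronglyMeasurable_mul_div h.aestronglyMeasurable_claim htI h.right_mem)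
      ((h.superMG U hU).mul_div_nonneg h.claim_nonneg htI h.right_mem)
      ((h.superMG V hV).aestronglyMeasurable_mul_div h.aestronglyMeasurable_claim htI h.right_mem)
      ((h.superMG V hV).mul_div_nonneg h.claim_nonneg htI h.right_mem) hB ?_
    filter_upwards [(h.superMG Y₀ hY₀).ae_pos hpos htI,
      (h.superMG U hU).ae_eq_zero_of_eq_zero htI h.right_mem ht.2.le] with ω h0 hU0 hωB
    rw [hBV ω hωB t₂ ht.2.le, hBV ω hωB t le_rfl]
    by_cases hUt : U t ω = 0
    · simp [hUt]
    · rw [div_self hUt, mul_one, mul_div_cancel_left₀ _ h0.ne']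
  have h1 := key Y hY A hA fun ω hω r hr => by simp [hVdef, hr.not_gt, hω]
  have h2 := key Y' hY' Aᶜ hA.compl fun ω hω r hr => by
    have : ω ∉ A := hω
    simp [hVdef, hr.not_gt, this]
  refine ⟨V, hV, ?_, ?_⟩
  · filter_upwards [h1, h2] with ω h1 h2
    by_cases hω : ω ∈ A
    · exact h1 hω
    · exact (le_of_lt (not_le.1 hω)).trans (h2 hω)
  · filter_upwards [h1, h2] with ω h1 h2
    by_cases hω : ω ∈ A
    · exact le_trans hω (h1 hω)
    · exact h2 hω

theorem ae_le_one [IsFiniteMeasure μ] (h : IsEssSupProcess μ T ℱ C t₁ t₂ g X) :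
    ∀ᵐ ω ∂μ, X t₁ ω ≤ 1 := by
  have key : (fun ω => ENNReal.ofReal (X t₁ ω)) ≤ᵐ[μ] fun _ => 1 := by
    rcases h.left_le_right.lt_or_eq with h12 | h12
    · exact h.least t₁ ⟨le_rfl, h12⟩ _ h.bound
    · obtain ⟨Y, hY, hpos⟩ := h.farReaching
      have hYm := h.superMG Y hY
      refine ae_le_of_setLIntegral_le_of_measurable (ℱ.le t₁)
        (h.stronglyMeasurable t₁ h.left_mem).measurable.ennreal_ofReal measurable_const
        fun A hA => ?_
      calc ∫⁻ ω in A, ENNReal.ofReal (X t₁ ω) ∂μ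
          = ∫⁻ ω in A, ENNReal.ofReal (g ω * (Y t₂ ω / Y t₁ ω)) ∂μ := by
            refine lintegral_congr_ae (ae_restrict_of_ae ?_)
            filter_upwards [hYm.ae_pos hpos h.left_mem] with ω hω
            rw [h.eq_claim t₁ h12.ge, ← h12, div_self hω.ne', mul_one]
        _ = ∫⁻ ω in A, econd μ (ℱ t₁) (fun ω => g ω * (Y t₂ ω / Y t₁ ω)) ω ∂μ :=
            (setLIntegral_econd (ℱ.le t₁) (hYm.aestronglyMeasurable_mul_div
              h.aestronglyMeasurable_claim h.left_mem h.right_mem)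
              (hYm.mul_div_nonneg h.claim_nonneg h.left_mem h.right_mem) hA).symm
        _ ≤ ∫⁻ _ in A, 1 ∂μ := lintegral_mono_ae (ae_restrict_of_ae (h.bound Y hY))
  filter_upwards [key] with ω hω
  simpa using hω

theorem setLIntegral_claim_le [IsFiniteMeasure μ] (h : IsEssSupProcess μ T ℱ C t₁ t₂ g X)
    {Y : ℝ → Ω → ℝ} (hY : Y ∈ C) {s : ℝ} (hs : s ∈ Ico t₁ t₂) {A : Set Ω}
    (hA : MeasurableSet[ℱ s] A) :
    ∫⁻ ω in A, ENNReal.ofReal (g ω * Y t₂ ω) ∂μ ≤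
      ∫⁻ ω in A, ENNReal.ofReal (X s ω * Y s ω) ∂μ := by
  have hsI := h.mem_Icc (Ico_subset_Icc_self hs)
  have key := (h.superMG Y hY).lintegral_econd_mul_mul h.aestronglyMeasurable_claim
    h.claim_nonneg hsI h.right_mem hs.2.le (W := A.indicator fun _ => 1)
    (measurable_const.indicator hA)
  rw [← lintegral_indicator (ℱ.le s _ hA), ← lintegral_indicator (ℱ.le s _ hA)]
  calc ∫⁻ ω, A.indicator (fun ω => ENNReal.ofReal (g ω * Y t₂ ω)) ω ∂μ
      = ∫⁻ ω, ENNReal.ofReal (g ω * Y t₂ ω) * A.indicator (fun _ => 1) ω ∂μ := by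
        refine lintegral_congr fun ω => ?_
        by_cases hω : ω ∈ A <;> simp [hω]
    _ = _ := key.symm
    _ ≤ _ := by
        refine lintegral_mono_ae ?_
        filter_upwards [h.upper s hs Y hY] with ω hω
        by_cases hωA : ω ∈ A
        · simp only [hωA, indicator_of_mem, mul_one,
            ENNReal.ofReal_mul (h.nonneg s ω)]
          exact mul_le_mul_left hω _
        · simp [hωA]

theorem setLIntegral_mul_le_of_mem_Ico [IsFiniteMeasure μ]
    (h : IsEssSupProcess μ T ℱ C t₁ t₂ g X) {Y : ℝ → Ω → ℝ} (hY : Y ∈ C) {s t : ℝ}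
    (hs : t₁ ≤ s) (hst : s < t) (ht : t < t₂) {A : Set Ω} (hA : MeasurableSet[ℱ s] A) :
    ∫⁻ ω in A, ENNReal.ofReal (X t ω * Y t ω) ∂μ ≤
      ∫⁻ ω in A, ENNReal.ofReal (X s ω * Y s ω) ∂μ := by
  have htI := h.mem_Icc ⟨hs.trans hst.le, ht.le⟩
  have hYt : Measurable[ℱ t] fun ω => ENNReal.ofReal (Y t ω) :=
    ((h.superMG Y hY).1.1 t htI).measurable.ennreal_ofReal
  have hWt : Measurable[ℱ t] (A.indicator fun ω => ENNReal.ofReal (Y t ω)) :=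
    hYt.indicator (ℱ.mono hst.le _ hA)
  have : Nonempty C := ⟨⟨Y, hY⟩⟩
  have key := lintegral_mul_le_of_directed_esssup (μ := μ) (ι := C)
    (E := fun Y' => econd μ (ℱ t) (fun ω => g ω * (Y'.1 t₂ ω / Y'.1 t ω)))
    (fun Y' => (measurable_econd _).mono (ℱ.le t) le_rfl)
    (fun Y₁ Y₂ => by
      obtain ⟨V, hV, h1, h2⟩ := h.directed ⟨hs.trans hst.le, ht⟩ Y₁.2 Y₂.2
      exact ⟨⟨V, hV⟩, h1, h2⟩)
    (x := fun ω => ENNReal.ofReal (X t ω))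
    ((h.stronglyMeasurable t htI).measurable.ennreal_ofReal.mono (ℱ.le t) le_rfl)
    (fun _ => ENNReal.ofReal_ne_top) (fun Y' => h.upper t ⟨hs.trans hst.le, ht⟩ _ Y'.2)
    (fun Z hZ => h.least t ⟨hs.trans hst.le, ht⟩ Z fun Y' hY' => hZ ⟨Y', hY'⟩)
    (W := A.indicator fun ω => ENNReal.ofReal (Y t ω))
    (hWt.mono (ℱ.le t) le_rfl) (R := ∫⁻ ω in A, ENNReal.ofReal (X s ω * Y s ω) ∂μ) (by
      rintro ⟨Y', hY'⟩
      have hV := h.forkConvex.concat_mem htI hY hY'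
      have hAm := ℱ.le s _ hA
      have h1 := h.setLIntegral_claim_le hV ⟨hs, hst.trans ht⟩ hA
      simp only [ht.not_gt, hst, if_true, if_false] at h1
      refine le_trans (le_of_eq ?_) h1
      rw [lintegral_econd_mul (ℱ.le t) ((h.superMG Y' hY').aestronglyMeasurable_mul_div
        h.aestronglyMeasurable_claim htI h.right_mem)
        ((h.superMG Y' hY').mul_div_nonneg h.claim_nonneg htI h.right_mem) hWt,
        ← lintegral_indicator hAm]
      refine lintegral_congr_ae ?_
      filter_upwards [(h.superMG Y' hY').mul_div_nonneg h.claim_nonneg htI h.right_mem] with ω hω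
      by_cases hωA : ω ∈ A
      · simp only [hωA, indicator_of_mem]
        rw [← ENNReal.ofReal_mul hω]
        congr 1
        ring
      · simp [hωA])
  refine le_trans (le_of_eq ?_) key
  rw [← lintegral_indicator (ℱ.le s _ hA)]
  refine lintegral_congr fun ω => ?_
  by_cases hωA : ω ∈ A
  · simp [hωA, ENNReal.ofReal_mul (h.nonneg t ω)]
  · simp [hωA]

theorem lsupermartingale_mul [IsFiniteMeasure μ] (h : IsEssSupProcess μ T ℱ C t₁ t₂ g X)
    {Y : ℝ → Ω → ℝ} (hY : Y ∈ C) :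
    LSupermartingale μ T ℱ fun t ω => ENNReal.ofReal (X t ω * Y t ω) := by
  have hy := (h.superMG Y hY).lsupermartingale
  refine ⟨fun t ht => ((h.stronglyMeasurable t ht).mul
    ((h.superMG Y hY).1.1 t ht)).measurable.ennreal_ofReal, fun s hs t ht hst A hA => ?_⟩
  have hpre : ∀ r ∈ Icc s T, r ≤ t₁ → ∫⁻ ω in A, ENNReal.ofReal (X r ω * Y r ω) ∂μ ≤
      ∫⁻ ω in A, ENNReal.ofReal (X s ω * Y s ω) ∂μ := by
    intro r hr hrt
    have hrI : r ∈ Icc (0 : ℝ) T := ⟨hs.1.trans hr.1, hr.2⟩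
    rcases hr.1.eq_or_lt with rfl | hsr
    · exact le_rfl
    have hX : ∀ᵐ ω ∂μ, X r ω ≤ 1 := by
      rcases hrt.lt_or_eq with hlt | rfl
      · exact ae_of_all _ fun ω => (h.eq_one r hlt ω).le
      · exact h.ae_le_one
    calc ∫⁻ ω in A, ENNReal.ofReal (X r ω * Y r ω) ∂μ
        ≤ ∫⁻ ω in A, ENNReal.ofReal (Y r ω) ∂μ := by
          refine lintegral_mono_ae (ae_restrict_of_ae ?_)
          filter_upwards [hX, (h.superMG Y hY).1.ae_nonneg hrI] with ω h1 h2
          exact ENNReal.ofReal_le_ofReal (mul_le_of_le_one_left h2 h1)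
      _ ≤ ∫⁻ ω in A, ENNReal.ofReal (Y s ω) ∂μ := hy.setLIntegral_le s hs r hrI hsr.le A hA
      _ = _ := by simp only [h.eq_one s (hsr.trans_le hrt), one_mul]
  have hpost : ∀ r ∈ Icc (0 : ℝ) T, t₂ ≤ r → r ≤ t → ∀ B, MeasurableSet[ℱ r] B →
      ∫⁻ ω in B, ENNReal.ofReal (X t ω * Y t ω) ∂μ ≤
        ∫⁻ ω in B, ENNReal.ofReal (X r ω * Y r ω) ∂μ := by
    intro r hr htr hrt B hB
    have hW : Measurable[ℱ r] (B.indicator fun ω => ENNReal.ofReal (g ω)) :=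
      (h.stronglyMeasurable_claim.mono (ℱ.mono htr)).measurable.ennreal_ofReal.indicator hB
    have key := lintegral_mul_le_of_setLIntegral_le (ℱ.le r)
      ((hy.measurable t ht).mono (ℱ.le t) le_rfl).aemeasurable
      ((hy.measurable r hr).mono (ℱ.le r) le_rfl).aemeasurable
      (hy.setLIntegral_le r hr t ht hrt) hW
    have heq : ∀ u, t₂ ≤ u → ∫⁻ ω in B, ENNReal.ofReal (X u ω * Y u ω) ∂μ =
        ∫⁻ ω, ENNReal.ofReal (Y u ω) * B.indicator (fun ω => ENNReal.ofReal (g ω)) ω ∂μ := by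
      intro u hu
      rw [← lintegral_indicator (ℱ.le r _ hB)]
      refine lintegral_congr fun ω => ?_
      by_cases hω : ω ∈ B
      · simp [hω, h.eq_claim u hu, ENNReal.ofReal_mul (h.claim_nonneg ω), mul_comm]
      · simp [hω]
    rw [heq t (htr.trans hrt), heq r htr]
    exact key
  rcases lt_or_ge t t₁ with htt | htt
  · exact hpre t ⟨hst, ht.2⟩ htt.le
  rcases le_or_gt t₂ s with hss | hss
  · exact hpost s hs hss hst A hA
  set s' := max s t₁ with hs'
  set t' := min t t₂ with ht'
  have hss' : s ≤ s' := le_max_left _ _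
  have hs't' : s' ≤ t' := max_le (le_min hst hss.le) (le_min htt h.left_le_right)
  have ht'I : t' ∈ Icc (0 : ℝ) T := ⟨hs.1.trans (hss'.trans hs't'), (min_le_left _ _).trans ht.2⟩
  have hs'I : s' ∈ Icc (0 : ℝ) T := ⟨hs.1.trans hss', hs't'.trans ht'I.2⟩
  have h1 : ∫⁻ ω in A, ENNReal.ofReal (X s' ω * Y s' ω) ∂μ ≤
      ∫⁻ ω in A, ENNReal.ofReal (X s ω * Y s ω) ∂μ := by
    rcases le_total s t₁ with h' | h'
    · exact hpre s' ⟨hss', hs'I.2⟩ (max_eq_right h').le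
    · rw [hs', max_eq_left h']
  have h3 : ∫⁻ ω in A, ENNReal.ofReal (X t ω * Y t ω) ∂μ ≤
      ∫⁻ ω in A, ENNReal.ofReal (X t' ω * Y t' ω) ∂μ := by
    rcases le_total t t₂ with h' | h'
    · rw [ht', min_eq_left h']
    · exact hpost t' ht'I (min_eq_right h').ge (min_le_left _ _) A
        (ℱ.mono (hss'.trans hs't') _ hA)
  refine h3.trans (le_trans ?_ h1)
  rcases hs't'.eq_or_lt with heq | hlt
  · rw [heq]
  have hA' := ℱ.mono hss' _ hA
  rcases (min_le_right t t₂ : t' ≤ t₂).eq_or_lt with heq | hlt'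
  · rw [show t' = t₂ from heq] at hlt ⊢
    simp only [h.eq_claim t₂ le_rfl]
    exact h.setLIntegral_claim_le hY ⟨le_max_right _ _, hlt⟩ hA'
  · exact h.setLIntegral_mul_le_of_mem_Ico hY (le_max_right _ _) hlt hlt' hA'

theorem supermartProp_mul [IsFiniteMeasure μ] (h : IsEssSupProcess μ T ℱ C t₁ t₂ g X)
    {Y : ℝ → Ω → ℝ} (hY : Y ∈ C) : SupermartProp μ T ℱ fun t ω => X t ω * Y t ω := by
  have hYm := h.superMG Y hY
  refine (h.lsupermartingale_mul hY).supermartProp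
    (fun t ht => (h.stronglyMeasurable t ht).mul (hYm.1.1 t ht))
    (fun t ht => (hYm.1.ae_nonneg ht).mono fun ω hω => mul_nonneg (h.nonneg t ω) hω) ?_
  have h0 : (0 : ℝ) ∈ Icc (0 : ℝ) T := ⟨le_rfl, h.left_mem.1.trans h.left_mem.2⟩
  have hX : ∀ᵐ ω ∂μ, X 0 ω ≤ 1 := by
    rcases h.left_mem.1.eq_or_lt with heq | hlt
    · rw [heq]
      exact h.ae_le_one
    · exact ae_of_all _ fun ω => (h.eq_one 0 hlt ω).le
  refine ne_top_of_le_ne_top ((hasFiniteIntegral_iff_ofReal (hYm.1.ae_nonneg h0)).1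
    (hYm.2.1 0 h0).2).ne (lintegral_mono_ae ?_)
  filter_upwards [hX, hYm.1.ae_nonneg h0] with ω h1 h2
  exact ENNReal.ofReal_le_ofReal (mul_le_of_le_one_left h2 h1)

end IsEssSupProcess

end EssSup

section Regularization

/-- A countable dense set of times in `[0, T]` containing `T`. -/
def timeGrid (T : ℝ) : Set ℝ := insert T (range ((↑) : ℚ → ℝ) ∩ Icc 0 T)

theorem countable_timeGrid (T : ℝ) : (timeGrid T).Countable :=
  ((countable_range _).mono inter_subset_left).insert T

theorem timeGrid_subset {T : ℝ} (hT : 0 ≤ T) : timeGrid T ⊆ Icc 0 T :=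
  insert_subset ⟨hT, le_rfl⟩ inter_subset_right

theorem exists_mem_timeGrid {T a b : ℝ} (ha : 0 ≤ a) (hab : a < b) (hb : b ≤ T) :
    ∃ s ∈ timeGrid T, a < s ∧ s < b := by
  obtain ⟨q, hq1, hq2⟩ := exists_rat_btwn hab
  exact ⟨q, Or.inr ⟨⟨q, rfl⟩, ha.trans hq1.le, hq2.le.trans hb⟩, hq1, hq2⟩

theorem nhdsWithin_timeGrid_Ioi_neBot {T t : ℝ} (ht : t ∈ Ico 0 T) :
    (𝓝[timeGrid T ∩ Ioi t] t).NeBot := by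
  rw [← mem_closure_iff_nhdsWithin_neBot, Metric.mem_closure_iff]
  intro ε hε
  obtain ⟨s, hs, h1, h2⟩ := exists_mem_timeGrid ht.1
    (lt_min ht.2 (lt_add_of_pos_right t hε)) (min_le_left T (t + ε))
  refine ⟨s, ⟨hs, h1⟩, ?_⟩
  have := h2.trans_le (min_le_right _ _)
  rw [Real.dist_eq, abs_sub_lt_iff]
  constructor <;> linarith

theorem nhdsWithin_timeGrid_Iio_neBot {T t : ℝ} (ht : t ∈ Ioc 0 T) :
    (𝓝[timeGrid T ∩ Iio t] t).NeBot := by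
  rw [← mem_closure_iff_nhdsWithin_neBot, Metric.mem_closure_iff]
  intro ε hε
  obtain ⟨s, hs, h1, h2⟩ := exists_mem_timeGrid (le_max_left 0 (t - ε))
    (max_lt ht.1 (sub_lt_self t hε)) ht.2
  refine ⟨s, ⟨hs, h2⟩, ?_⟩
  have := (le_max_right _ _).trans_lt h1
  rw [Real.dist_eq, abs_sub_lt_iff]
  constructor <;> linarith

theorem cadlagOn_of_tendsto_timeGrid {T : ℝ} {f F : ℝ → ℝ}
    (hr : ∀ t ∈ Ico 0 T, Tendsto f (𝓝[timeGrid T ∩ Ioi t] t) (𝓝 (F t)))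
    (hl : ∀ t ∈ Ioc 0 T, ∃ L, Tendsto f (𝓝[timeGrid T ∩ Iio t] t) (𝓝 L)) : CadlagOn T F := by
  have key : ∀ V : Set ℝ, IsClosed V → ∀ a b : ℝ, 0 ≤ a → b ≤ T →
      (∀ s ∈ timeGrid T, a < s → s < b → f s ∈ V) → ∀ u, a < u → u < b → F u ∈ V := by
    intro V hV a b ha hb h u hau hub
    have hu : u ∈ Ico 0 T := ⟨ha.trans hau.le, hub.trans_le hb⟩
    have := nhdsWithin_timeGrid_Ioi_neBot hu
    refine hV.mem_of_tendsto (hr u hu) ?_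
    have h2 : ∀ᶠ s in 𝓝[timeGrid T ∩ Ioi u] u, s < b := nhdsWithin_le_nhds (Iio_mem_nhds hub)
    filter_upwards [eventually_mem_nhdsWithin, h2] with s hs hsb
    exact h s hs.1 (hau.trans hs.2) hsb
  constructor
  · intro t ht
    refine (closed_nhds_basis (F t)).tendsto_right_iff.2 fun V ⟨hV, hVc⟩ => ?_
    have h1 := hr t ht hV
    rw [mem_map, mem_nhdsWithin_iff_eventually] at h1
    obtain ⟨b, htb, hb⟩ := (mem_nhdsGE_iff_exists_Ico_subset.1 (mem_nhdsWithin_of_mem_nhds h1))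
    filter_upwards [Ioo_mem_nhdsGT (lt_min htb ht.2)] with u hu
    refine key V hVc t (min b T) ht.1 (min_le_right _ _) (fun s hs hts hsb => ?_) u hu.1 hu.2
    exact hb ⟨hts.le, hsb.trans_le (min_le_left _ _)⟩ ⟨hs, hts⟩
  · intro t ht
    obtain ⟨L, hL⟩ := hl t ht
    refine ⟨L, (closed_nhds_basis L).tendsto_right_iff.2 fun V ⟨hV, hVc⟩ => ?_⟩
    have h1 := hL hV
    rw [mem_map, mem_nhdsWithin_iff_eventually] at h1
    obtain ⟨a, hat, ha⟩ := (mem_nhdsLE_iff_exists_Ioc_subset.1 (mem_nhdsWithin_of_mem_nhds h1))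
    filter_upwards [Ioo_mem_nhdsLT (max_lt hat ht.1)] with u hu
    refine key V hVc (max a 0) t (le_max_right _ _) ht.2 (fun s hs has hst => ?_) u hu.1 hu.2
    exact ha ⟨(le_max_left _ _).trans_lt has, hst.le⟩ ⟨hs, hst⟩

theorem exists_seq_timeGrid {T t x : ℝ} (ht : t ∈ Ico 0 T) (hx : t < x) :
    ∃ s : ℕ → ℝ, (∀ n, s n ∈ timeGrid T ∩ Ioo t x) ∧
      Tendsto s atTop (𝓝[timeGrid T ∩ Ioi t] t) := by
  have := nhdsWithin_timeGrid_Ioi_neBot ht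
  obtain ⟨s, hs⟩ := exists_seq_tendsto (𝓝[timeGrid T ∩ Ioi t] t)
  have h1 : ∀ᶠ r in 𝓝[timeGrid T ∩ Ioi t] t, r ∈ timeGrid T ∩ Ioo t x := by
    have h2 : ∀ᶠ r in 𝓝[timeGrid T ∩ Ioi t] t, r < x := nhdsWithin_le_nhds (Iio_mem_nhds hx)
    filter_upwards [eventually_mem_nhdsWithin, h2] with r hr hrx
    exact ⟨hr.1, hr.2, hrx⟩
  obtain ⟨N, hN⟩ := eventually_atTop.1 (hs.eventually h1)
  exact ⟨fun n => s (n + N), fun n => hN _ (Nat.le_add_left _ _),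
    hs.comp (tendsto_add_atTop_nat N)⟩

variable {m0 : MeasurableSpace Ω} {μ : Measure Ω} {T : ℝ} {ℱ : Filtration ℝ m0}

theorem measurable_of_forall_gt {t : ℝ} (hrc : (ℱ t : MeasurableSpace Ω) = ⨅ (s : ℝ) (_ : t < s), ℱ s)
    {f : Ω → ℝ≥0∞} (hf : ∀ r, t < r → Measurable[ℱ r] f) : Measurable[ℱ t] f := by
  rw [measurable_iff_comap_le, hrc]
  exact le_iInf₂ fun r hr => (hf r hr).comap_le

theorem measurable_liminf_of_tendsto {t : ℝ}
    (hrc : (ℱ t : MeasurableSpace Ω) = ⨅ (s : ℝ) (_ : t < s), ℱ s) {s : ℕ → ℝ}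
    (hs : Tendsto s atTop (𝓝 t)) {f : ℕ → Ω → ℝ≥0∞} (hf : ∀ n, Measurable[ℱ (s n)] (f n)) :
    Measurable[ℱ t] fun ω => liminf (fun n => f n ω) atTop := by
  refine measurable_of_forall_gt hrc fun r hr => ?_
  obtain ⟨N, hN⟩ := eventually_atTop.1 (hs.eventually_le_const hr)
  simp_rw [← liminf_nat_add (fun n => f n _) N]
  exact Measurable.liminf fun n => (hf _).mono (ℱ.mono (hN _ (Nat.le_add_left _ _))) le_rfl

theorem measurable_limsup_of_tendsto {t : ℝ}
    (hrc : (ℱ t : MeasurableSpace Ω) = ⨅ (s : ℝ) (_ : t < s), ℱ s) {s : ℕ → ℝ}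
    (hs : Tendsto s atTop (𝓝 t)) {f : ℕ → Ω → ℝ≥0∞} (hf : ∀ n, Measurable[ℱ (s n)] (f n)) :
    Measurable[ℱ t] fun ω => limsup (fun n => f n ω) atTop := by
  refine measurable_of_forall_gt hrc fun r hr => ?_
  obtain ⟨N, hN⟩ := eventually_atTop.1 (hs.eventually_le_const hr)
  simp_rw [← limsup_nat_add (fun n => f n _) N]
  exact Measurable.limsup fun n => (hf _).mono (ℱ.mono (hN _ (Nat.le_add_left _ _))) le_rfl

theorem LSupermartingale.liminf_le [IsFiniteMeasure μ] {z : ℝ → Ω → ℝ≥0∞}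
    (hz : LSupermartingale μ T ℱ z) {t : ℝ} (ht : t ∈ Icc 0 T)
    (hrc : (ℱ t : MeasurableSpace Ω) = ⨅ (s : ℝ) (_ : t < s), ℱ s) {s : ℕ → ℝ}
    (hs : Tendsto s atTop (𝓝 t)) (hsT : ∀ n, s n ∈ Icc t T) :
    (fun ω => liminf (fun n => z (s n) ω) atTop) ≤ᵐ[μ] z t := by
  have hsI : ∀ n, s n ∈ Icc (0 : ℝ) T := fun n => ⟨ht.1.trans (hsT n).1, (hsT n).2⟩
  refine ae_le_of_setLIntegral_le_of_measurable (ℱ.le t)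
    (measurable_liminf_of_tendsto hrc hs fun n => hz.measurable _ (hsI n)) (hz.measurable t ht)
    fun A hA => ?_
  refine (lintegral_liminf_le fun n => (hz.measurable _ (hsI n)).mono (ℱ.le _) le_rfl).trans ?_
  exact liminf_le_of_le (by isBoundedDefault) fun b hb => by
    obtain ⟨n, hn⟩ := hb.exists
    exact hn.trans (hz.setLIntegral_le t ht _ (hsI n) (hsT n).1 A hA)

theorem setLIntegral_le_setLIntegral_limsup [IsFiniteMeasure μ] {t : ℝ} {s : ℕ → ℝ}
    (hs : ∀ n, t ≤ s n) {z : ℕ → Ω → ℝ≥0∞} (hz : ∀ n, Measurable[ℱ (s n)] (z n))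
    {h : Ω → ℝ≥0∞} (hh : AEMeasurable h μ)
    (hle : ∀ n, ∀ A, MeasurableSet[ℱ (s n)] A → ∫⁻ ω in A, h ω ∂μ ≤ ∫⁻ ω in A, z n ω ∂μ)
    {A : Set Ω} (hA : MeasurableSet[ℱ t] A) :
    ∫⁻ ω in A, h ω ∂μ ≤ ∫⁻ ω in A, limsup (fun n => z n ω) atTop ∂μ := by
  have key : ∀ k : ℕ, ∫⁻ ω in A, min (h ω) k ∂μ ≤
      ∫⁻ ω in A, limsup (fun n => z n ω) atTop ∂μ := by
    intro k
    have hmin : ∀ n, ∫⁻ ω in A, min (h ω) k ∂μ ≤ ∫⁻ ω in A, min (z n ω) k ∂μ := by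
      intro n
      have hB : MeasurableSet[ℱ (s n)] {ω | z n ω < k} :=
        measurableSet_lt (hz n) measurable_const
      have hA' := ℱ.mono (hs n) _ hA
      rw [← lintegral_inter_add_sdiff _ A (ℱ.le _ _ hB),
        ← lintegral_inter_add_sdiff (fun ω => min (z n ω) k) A (ℱ.le _ _ hB)]
      refine add_le_add ?_ ?_
      · refine (lintegral_mono fun ω => min_le_left _ _).trans ((hle n _ (hA'.inter hB)).trans ?_)
        exact setLIntegral_mono' (ℱ.le _ _ (hA'.inter hB)) fun ω hω => le_min le_rfl (le_of_lt hω.2)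
      · exact setLIntegral_mono' (ℱ.le _ _ (hA'.diff hB)) fun ω hω =>
          le_min ((min_le_right _ _).trans (not_lt.1 hω.2)) (min_le_right _ _)
    calc ∫⁻ ω in A, min (h ω) k ∂μ
        ≤ limsup (fun n => ∫⁻ ω in A, min (z n ω) k ∂μ) atTop :=
          le_limsup_of_frequently_le (Eventually.of_forall hmin).frequently (by isBoundedDefault)
      _ ≤ ∫⁻ ω in A, limsup (fun n => min (z n ω) k) atTop ∂μ :=
          limsup_lintegral_le (fun _ => (k : ℝ≥0∞))
            (fun n => ((hz n).mono (ℱ.le _) le_rfl).min measurable_const)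
            (fun n => ae_of_all _ fun ω => min_le_right _ _)
            (by simp [ENNReal.mul_eq_top])
      _ ≤ _ := lintegral_mono fun ω => limsup_le_limsup
          (Eventually.of_forall fun n => min_le_left _ _)
  have hsup : ∫⁻ ω in A, h ω ∂μ = ⨆ k : ℕ, ∫⁻ ω in A, min (h ω) k ∂μ := by
    rw [← lintegral_iSup' (fun k => (hh.restrict.min aemeasurable_const))
      (ae_of_all _ fun ω i j hij => min_le_min_left _ (by exact_mod_cast hij))]
    refine lintegral_congr fun ω => ?_
    rw [← inf_iSup_eq (h ω) (fun k : ℕ => (k : ℝ≥0∞)), ENNReal.iSup_natCast]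
    simp
  rw [hsup]
  exact iSup_le key

end Regularization

section Modification

variable {m0 : MeasurableSpace Ω} {μ : Measure Ω} {T : ℝ} {ℱ : Filtration ℝ m0}

/-- Dividing a process by a càdlàg one that is bounded below preserves one-sided limits. -/
theorem exists_tendsto_div_of_cadlagOn {x y : ℝ → ℝ} (hy : CadlagOn T y) {c : ℝ} (hc : 0 < c)
    (hcy : ∀ s ∈ timeGrid T, c ≤ y s)
    (hr : ∀ t, 0 ≤ t → ∃ L, Tendsto (fun s => x s * y s) (𝓝[timeGrid T ∩ Ioi t] t) (𝓝 L))
    (hl : ∀ t, 0 < t → ∃ L, Tendsto (fun s => x s * y s) (𝓝[timeGrid T ∩ Iio t] t) (𝓝 L)) :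
    (∀ t ∈ Ico 0 T, ∃ L, Tendsto x (𝓝[timeGrid T ∩ Ioi t] t) (𝓝 L)) ∧
      ∀ t ∈ Ioc 0 T, ∃ L, Tendsto x (𝓝[timeGrid T ∩ Iio t] t) (𝓝 L) := by
  have key : ∀ (E : Set ℝ) (t L M : ℝ), (𝓝[timeGrid T ∩ E] t).NeBot →
      Tendsto (fun s => x s * y s) (𝓝[timeGrid T ∩ E] t) (𝓝 L) →
      Tendsto y (𝓝[E] t) (𝓝 M) → Tendsto x (𝓝[timeGrid T ∩ E] t) (𝓝 (L / M)) := by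
    intro E t L M _ hL hM
    have hM' := hM.mono_left (nhdsWithin_mono t (inter_subset_right (s := timeGrid T)))
    have hmem : ∀ᶠ s in 𝓝[timeGrid T ∩ E] t, c ≤ y s :=
      eventually_mem_nhdsWithin.mono fun s hs => hcy s hs.1
    have hM0 : M ≠ 0 := (hc.trans_le (ge_of_tendsto hM' hmem)).ne'
    refine (hL.div hM' hM0).congr' (hmem.mono fun s hs => ?_)
    exact mul_div_cancel_right₀ _ (hc.trans_le hs).ne'
  constructor
  · intro t ht
    obtain ⟨L, hL⟩ := hr t ht.1
    exact ⟨_, key _ t L _ (nhdsWithin_timeGrid_Ioi_neBot ht) hL (hy.1 t ht)⟩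
  · intro t ht
    obtain ⟨L, hL⟩ := hl t ht.1
    obtain ⟨M, hM⟩ := hy.2 t ht
    exact ⟨_, key _ t L M (nhdsWithin_timeGrid_Iio_neBot ht) hL hM⟩

namespace IsEssSupProcess

variable {C : Set (ℝ → Ω → ℝ)} {t₁ t₂ : ℝ} {g : Ω → ℝ} {X : ℝ → Ω → ℝ}

theorem ae_exists_tendsto [IsProbabilityMeasure μ] (h : IsEssSupProcess μ T ℱ C t₁ t₂ g X) :
    ∀ᵐ ω ∂μ, (∀ t ∈ Ico 0 T, ∃ L, Tendsto (fun s => X s ω) (𝓝[timeGrid T ∩ Ioi t] t) (𝓝 L)) ∧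
      ∀ t ∈ Ioc 0 T, ∃ L, Tendsto (fun s => X s ω) (𝓝[timeGrid T ∩ Iio t] t) (𝓝 L) := by
  obtain ⟨Y, hY, hpos⟩ := h.farReaching
  have hYm := h.superMG Y hY
  have hT : 0 ≤ T := h.left_mem.1.trans h.left_mem.2
  filter_upwards [hpos, hYm.1.2.2, hYm.lsupermartingale.ae_bounded_below hT (countable_timeGrid T)
    (timeGrid_subset hT), (h.supermartProp_mul hY).ae_exists_tendsto hT
    (fun t ht => (hYm.1.ae_nonneg ht).mono fun ω hω => mul_nonneg (h.nonneg t ω) hω)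
    (countable_timeGrid T) (timeGrid_subset hT)] with ω hp hcad hbelow hlim
  obtain ⟨n, hn⟩ := hbelow (ENNReal.ofReal_pos.2 hp).ne'
  have hn0 : n ≠ 0 := by
    rintro rfl
    simpa using hn T (Or.inl rfl)
  refine exists_tendsto_div_of_cadlagOn hcad (c := (n : ℝ)⁻¹) (by positivity) (fun s hs => ?_)
    hlim.1 hlim.2
  have := hn s hs
  rw [← ENNReal.ofReal_natCast, ← ENNReal.ofReal_inv_of_pos (by positivity),
    ENNReal.ofReal_lt_ofReal_iff'] at this
  exact this.1.le

theorem ae_econd_eq_zero [IsFiniteMeasure μ] (h : IsEssSupProcess μ T ℱ C t₁ t₂ g X)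
    {Y : ℝ → Ω → ℝ} (hY : Y ∈ C) {t : ℝ} (ht : t ∈ Icc t₁ t₂) :
    ∀ᵐ ω ∂μ, Y t ω = 0 → econd μ (ℱ t) (fun ω => g ω * (Y t₂ ω / Y t ω)) ω = 0 := by
  have htI := h.mem_Icc ht
  have hYm := h.superMG Y hY
  have h0 : econd μ (ℱ t) (fun _ => (0 : ℝ)) = 0 := by
    ext ω
    simp [econd]
  have hA : MeasurableSet[ℱ t] {ω | Y t ω = 0} :=
    (hYm.1.1 t htI).measurable (measurableSet_singleton 0)
  filter_upwards [ae_econd_eq_of_ae_eq_on (ℱ.le t)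
    (hYm.aestronglyMeasurable_mul_div h.aestronglyMeasurable_claim htI h.right_mem)
    (hYm.mul_div_nonneg h.claim_nonneg htI h.right_mem)
    (f' := fun _ => 0) aestronglyMeasurable_const (ae_of_all _ fun _ => le_rfl) hA
    (ae_of_all _ fun ω hω => by simp [show Y t ω = 0 from hω])] with ω hω hYω
  exact nonpos_iff_eq_zero.1 ((hω hYω).trans_eq (congrFun h0 ω))

theorem ae_tendsto_mul [IsFiniteMeasure μ] (h : IsEssSupProcess μ T ℱ C t₁ t₂ g X)
    {Y : ℝ → Ω → ℝ} (hY : Y ∈ C) {t : ℝ} (ht : t ∈ Ico 0 T) {R : Ω → ℝ}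
    (hR : ∀ᵐ ω ∂μ, Tendsto (fun s => X s ω) (𝓝[timeGrid T ∩ Ioi t] t) (𝓝 (R ω))) :
    ∀ᵐ ω ∂μ, Tendsto (fun s => ENNReal.ofReal (X s ω * Y s ω)) (𝓝[timeGrid T ∩ Ioi t] t)
      (𝓝 (ENNReal.ofReal (R ω * Y t ω))) := by
  filter_upwards [hR, (h.superMG Y hY).1.2.2] with ω h1 h2
  exact (ENNReal.continuous_ofReal.tendsto _).comp
    (h1.mul ((h2.1 t ht).mono_left (nhdsWithin_mono t inter_subset_right)))

theorem ae_rightLimit_eq [IsFiniteMeasure μ] (h : IsEssSupProcess μ T ℱ C t₁ t₂ g X)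
    (hrc : ∀ t : ℝ, (ℱ t : MeasurableSpace Ω) = ⨅ (s : ℝ) (_ : t < s), ℱ s) {t : ℝ}
    (ht : t ∈ Ico 0 T) {R : Ω → ℝ}
    (hR : ∀ᵐ ω ∂μ, Tendsto (fun s => X s ω) (𝓝[timeGrid T ∩ Ioi t] t) (𝓝 (R ω))) :
    R =ᵐ[μ] X t := by
  have hne := nhdsWithin_timeGrid_Ioi_neBot ht
  by_cases htt : t ∈ Ico t₁ t₂
  swap
  · obtain ⟨u, htu, hu⟩ : ∃ u > t, ∀ s ∈ Ioo t u, ∀ ω, X s ω = X t ω := by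
      by_cases h1 : t < t₁
      · exact ⟨t₁, h1, fun s hs ω => by rw [h.eq_one s hs.2, h.eq_one t h1]⟩
      · have h2 : t₂ ≤ t := by
          by_contra h2
          exact htt ⟨not_lt.1 h1, not_le.1 h2⟩
        exact ⟨t + 1, lt_add_one t, fun s hs ω => by
          rw [h.eq_claim s (h2.trans hs.1.le), h.eq_claim t h2]⟩
    filter_upwards [hR] with ω hω
    refine tendsto_nhds_unique hω (tendsto_const_nhds.congr' ?_)
    have h2 : ∀ᶠ r in 𝓝[timeGrid T ∩ Ioi t] t, r < u := nhdsWithin_le_nhds (Iio_mem_nhds htu)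
    filter_upwards [eventually_mem_nhdsWithin, h2] with r hr hru
    exact (hu r ⟨hr.2, hru⟩ ω).symm
  have htI : t ∈ Icc (0 : ℝ) T := Ico_subset_Icc_self ht
  obtain ⟨s, hs, hst⟩ := exists_seq_timeGrid ht htt.2
  have hst' : Tendsto s atTop (𝓝 t) := hst.mono_right nhdsWithin_le_nhds
  have hsI : ∀ n, s n ∈ Icc t T := fun n => ⟨(hs n).2.1.le, (hs n).2.2.le.trans h.right_mem.2⟩
  have hR0 : ∀ᵐ ω ∂μ, 0 ≤ R ω := by
    filter_upwards [hR] with ω hω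
    exact ge_of_tendsto' hω fun s => h.nonneg s ω
  have hle : R ≤ᵐ[μ] X t := by
    obtain ⟨Y, hY, hpos⟩ := h.farReaching
    filter_upwards [(h.lsupermartingale_mul hY).liminf_le htI (hrc t) hst' hsI,
      h.ae_tendsto_mul hY ht hR, (h.superMG Y hY).ae_pos hpos htI] with ω h1 h2 h3
    have h4 := (h2.comp hst).liminf_eq
    rw [Function.comp_def] at h4
    rw [h4, ENNReal.ofReal_le_ofReal_iff
      (mul_nonneg (h.nonneg t ω) h3.le)] at h1
    exact le_of_mul_le_mul_right h1 h3
  have hge : (fun ω => ENNReal.ofReal (X t ω)) ≤ᵐ[μ] fun ω => ENNReal.ofReal (R ω) := by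
    refine h.least t htt _ fun Y hY => ?_
    have hYm := h.superMG Y hY
    have hzm : ∀ n, Measurable[ℱ (s n)] fun ω => ENNReal.ofReal (X (s n) ω * Y (s n) ω) :=
      fun n => (h.lsupermartingale_mul hY).measurable _ ⟨ht.1.trans (hsI n).1, (hsI n).2⟩
    have hem : Measurable[ℱ t] fun ω => econd μ (ℱ t) (fun ω => g ω * (Y t₂ ω / Y t ω)) ω *
        ENNReal.ofReal (Y t ω) :=
      (measurable_econd _).mul (hYm.1.1 t htI).measurable.ennreal_ofReal
    have key : (fun ω => econd μ (ℱ t) (fun ω => g ω * (Y t₂ ω / Y t ω)) ω *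
        ENNReal.ofReal (Y t ω)) ≤ᵐ[μ]
        fun ω => limsup (fun n => ENNReal.ofReal (X (s n) ω * Y (s n) ω)) atTop := by
      refine ae_le_of_setLIntegral_le_of_measurable (ℱ.le t) hem
        (measurable_limsup_of_tendsto (hrc t) hst' hzm) fun A hA => ?_
      have h1 := setLIntegral_le_setLIntegral_limsup (μ := μ) (fun n => (hsI n).1) hzm
        (h := fun ω => ENNReal.ofReal (g ω * Y t₂ ω))
        (h.aestronglyMeasurable_claim.mul
          (hYm.aestronglyMeasurable h.right_mem)).aemeasurable.ennreal_ofReal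
        (fun n B hB => h.setLIntegral_claim_le hY
          ⟨htt.1.trans (hsI n).1, (hs n).2.2⟩ hB) hA
      refine le_trans (le_of_eq ?_) h1
      have h2 := hYm.lintegral_econd_mul_mul h.aestronglyMeasurable_claim h.claim_nonneg htI
        h.right_mem htt.2.le (W := A.indicator fun _ => 1) (measurable_const.indicator hA)
      rw [← lintegral_indicator (ℱ.le t _ hA), ← lintegral_indicator (ℱ.le t _ hA)]
      refine Eq.trans (lintegral_congr fun ω => ?_) (h2.trans (lintegral_congr fun ω => ?_)) <;>
        by_cases hω : ω ∈ A <;> simp [hω]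
    filter_upwards [key, h.ae_tendsto_mul hY ht hR, hR0,
      h.ae_econd_eq_zero hY (Ico_subset_Icc_self htt), hYm.1.ae_nonneg htI] with ω h1 h2 h3 h4 h5
    rcases h5.lt_or_eq with hpos | h0
    · have h6 := (h2.comp hst).limsup_eq
      rw [Function.comp_def] at h6
      rw [h6, ENNReal.ofReal_mul h3] at h1
      exact (ENNReal.mul_le_mul_iff_left (ENNReal.ofReal_pos.2 hpos).ne'
        ENNReal.ofReal_ne_top).1 h1
    · rw [h4 h0.symm]
      exact zero_le
  filter_upwards [hle, hge, hR0] with ω h1 h2 h3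
  exact le_antisymm h1 ((ENNReal.ofReal_le_ofReal_iff h3).1 h2)

theorem exists_cadlag_modification [IsProbabilityMeasure μ]
    (h : IsEssSupProcess μ T ℱ C t₁ t₂ g X)
    (hrc : ∀ t : ℝ, (ℱ t : MeasurableSpace Ω) = ⨅ (s : ℝ) (_ : t < s), ℱ s) :
    ∃ X' : ℝ → Ω → ℝ, (∀ ω, CadlagOn T fun t => X' t ω) ∧
      ∀ t ∈ Icc (0 : ℝ) T, X' t =ᵐ[μ] X t := by
  classical
  set G : Ω → Prop := fun ω =>
    (∀ t ∈ Ico 0 T, ∃ L, Tendsto (fun s => X s ω) (𝓝[timeGrid T ∩ Ioi t] t) (𝓝 L)) ∧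
      ∀ t ∈ Ioc 0 T, ∃ L, Tendsto (fun s => X s ω) (𝓝[timeGrid T ∩ Iio t] t) (𝓝 L) with hGdef
  have hG : ∀ᵐ ω ∂μ, G ω := h.ae_exists_tendsto
  set X' : ℝ → Ω → ℝ := fun t ω => if G ω then
    if t < T then limUnder (𝓝[timeGrid T ∩ Ioi t] t) (fun s => X s ω) else X T ω else 0 with hX'
  have hlim : ∀ ω, G ω → ∀ t ∈ Ico 0 T,
      Tendsto (fun s => X s ω) (𝓝[timeGrid T ∩ Ioi t] t) (𝓝 (X' t ω)) := by
    intro ω hω t ht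
    have := tendsto_nhds_limUnder (hω.1 t ht)
    simpa only [hX', hω, ht.2, if_true] using this
  refine ⟨X', fun ω => ?_, fun t ht => ?_⟩
  · by_cases hω : G ω
    · exact cadlagOn_of_tendsto_timeGrid (hlim ω hω) hω.2
    · simp only [hX', hω, if_false]
      exact ⟨fun t _ => tendsto_const_nhds, fun t _ => ⟨0, tendsto_const_nhds⟩⟩
  · rcases ht.2.lt_or_eq with htT | rfl
    · exact h.ae_rightLimit_eq hrc ⟨ht.1, htT⟩ (hG.mono fun ω hω => hlim ω hω t ⟨ht.1, htT⟩)
    · filter_upwards [hG] with ω hω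
      simp [hX', hω]

end IsEssSupProcess

end Modification

end Helpers

/-- Let `C ⊆ S` be fork-convex and far-reaching, `t₁ ≤ t₂` in `[0,T]`, and let `g ≥ 0`
be `F_{t₂}`-measurable and integrable with `esssup_{Y∈C} E[g Δ_{t₂,t₁}Y | F_{t₁}] ≤ 1` a.s.
If `X` is (a version of) the process equal to `1` before `t₁`, to
`esssup_{Y∈C} E[g Δ_{t₂,t}Y | F_t]` on `[t₁,t₂)` and to `g` from `t₂` on, then `X·Y` is a
supermartingale for every `Y ∈ C` and `X` admits a càdlàg modification. -/
theorem esssup_process_supermartingale {m0 : MeasurableSpace Ω} (μ : Measure Ω)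
    [IsProbabilityMeasure μ] (T : ℝ) (hT : 0 < T) (ℱ : Filtration ℝ m0)
    (hrc : ∀ t : ℝ, (ℱ t : MeasurableSpace Ω) = ⨅ (s : ℝ) (_ : t < s), ℱ s)
    (hcomp : ∀ A : Set Ω, μ A = 0 → MeasurableSet[ℱ 0] A)
    (htriv : ∀ A : Set Ω, MeasurableSet[ℱ 0] A → μ A = 0 ∨ μ A = 1)
    (C : Set (ℝ → Ω → ℝ)) (hC : ∀ X ∈ C, SuperMG μ T ℱ X)
    (hfork : ForkConvex μ T ℱ C) (hfar : FarReaching μ T C)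
    (t₁ t₂ : ℝ) (ht₁ : t₁ ∈ Set.Icc (0 : ℝ) T) (ht₂ : t₂ ∈ Set.Icc (0 : ℝ) T)
    (h12 : t₁ ≤ t₂)
    (g : Ω → ℝ) (hgm : StronglyMeasurable[ℱ t₂] g) (hg0 : ∀ ω, 0 ≤ g ω)
    (hgi : Integrable g μ)
    (X : ℝ → Ω → ℝ)
    (hXmeas : ∀ t ∈ Set.Icc (0 : ℝ) T, StronglyMeasurable[ℱ t] (X t))
    (hXnn : ∀ t, ∀ ω, 0 ≤ X t ω)
    (hXpre : ∀ t, t < t₁ → ∀ ω, X t ω = 1)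
    (hXpost : ∀ t, t₂ ≤ t → ∀ ω, X t ω = g ω)
    -- on `[t₁,t₂)`, `X t` is an upper bound …
    (hXub : ∀ t ∈ Set.Ico t₁ t₂, ∀ Y ∈ C,
      econd μ (ℱ t) (fun ω => g ω * (Y t₂ ω / Y t ω)) ≤ᵐ[μ]
        fun ω => ENNReal.ofReal (X t ω))
    -- … and the least one, i.e. the essential supremum of the family
    (hXlub : ∀ t ∈ Set.Ico t₁ t₂, ∀ Z : Ω → ℝ≥0∞,
      (∀ Y ∈ C, econd μ (ℱ t) (fun ω => g ω * (Y t₂ ω / Y t ω)) ≤ᵐ[μ] Z) →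
        (fun ω => ENNReal.ofReal (X t ω)) ≤ᵐ[μ] Z)
    -- the essential supremum at `t₁` is at most `1` a.s.
    (hbound : ∀ Y ∈ C,
      econd μ (ℱ t₁) (fun ω => g ω * (Y t₂ ω / Y t₁ ω)) ≤ᵐ[μ] fun _ => (1 : ℝ≥0∞)) :
    (∀ Y ∈ C, SupermartProp μ T ℱ (fun t ω => X t ω * Y t ω)) ∧
    ∃ X' : ℝ → Ω → ℝ, (∀ ω, CadlagOn T (fun t => X' t ω)) ∧
      ∀ t ∈ Set.Icc (0 : ℝ) T, X' t =ᵐ[μ] X t := by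
  have h : IsEssSupProcess μ T ℱ C t₁ t₂ g X :=
    ⟨hC, hfork, hfar, ht₁, ht₂, h12, hgm, hg0, hXmeas, hXnn, hXpre, hXpost, hXub, hXlub, hbound⟩
  exact ⟨fun Y hY => h.supermartProp_mul hY, h.exists_cadlag_modification hrc⟩
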